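/- arXiv:2301.12397 — 5 statements merged into one kernel-verified Lean document; each statement's English description precedes it below -/
import Mathlib

section
/- Let G be a finite group admitting a group of automorphisms A with gcd(|A|,|G|) = 1, and let m be a positive integer such that either (a) every element g ∈ C_G(A) has a left Engel sink 𝓔_G(g) of cardinality at most m, or (b) every element g ∈ C_G(A) has a right Engel sink 𝓡_G(g) of cardinality at most m. If G = F_2(G) (that is, G/F(G) is nilpotent), then the order of the centralizer C_{G/F(G)}(A) of A in G/F(G) is bounded in terms of m alone. -/
/-! Common definitions: Engel sinks, rank, Fitting series, soluble radical, etc. -/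

section Defs

variable {G : Type*} [Group G]

/-- The group-theoretic commutator `[a,b] = a⁻¹ b⁻¹ a b`. -/
def gComm (a b : G) : G := a⁻¹ * b⁻¹ * a * b

/-- The iterated (left-normed) Engel commutator `[x, g, g, …, g]` with `g` repeated `n` times. -/
def engel (x g : G) : ℕ → G
  | 0 => x
  | n + 1 => gComm (engel x g n) g

/-- `E` is a left Engel sink of `g`: for every `x` all sufficiently long commutators
`[x, g, g, …, g]` lie in `E`. -/
def IsLeftEngelSink (g : G) (E : Set G) : Prop :=
  ∀ x : G, ∃ N : ℕ, 0 < N ∧ ∀ l : ℕ, N ≤ l → engel x g l ∈ E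

/-- `R` is a right Engel sink of `g`: for every `x` all sufficiently long commutators
`[g, x, x, …, x]` lie in `R`. -/
def IsRightEngelSink (g : G) (R : Set G) : Prop :=
  ∀ x : G, ∃ N : ℕ, 0 < N ∧ ∀ l : ℕ, N ≤ l → engel g x l ∈ R

/-- The smallest left Engel sink `𝓔_G(g)` of `g` (in a finite group the intersection of all
left Engel sinks is again a left Engel sink, hence the smallest one). -/
def leftEngelSink (g : G) : Set G := ⋂₀ {E : Set G | IsLeftEngelSink g E}

/-- The smallest right Engel sink `𝓡_G(g)` of `g`. -/
def rightEngelSink (g : G) : Set G := ⋂₀ {R : Set G | IsRightEngelSink g R}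

/-- `rankLe H r`: the group `H` has rank at most `r`, i.e. every subgroup of `H`
can be generated by at most `r` elements. -/
def rankLe (H : Type*) [Group H] (r : ℕ) : Prop :=
  ∀ K : Subgroup H, ∃ S : Finset H, S.card ≤ r ∧ Subgroup.closure (S : Set H) = K

/-- The fixed-point subgroup `C_G(A)` of a group of automorphisms `A ≤ Aut G`. -/
def fixedSubgroup (A : Subgroup (MulAut G)) : Subgroup G where
  carrier := {g : G | ∀ a ∈ A, a g = g}
  one_mem' := fun a _ => map_one a
  mul_mem' := fun {x y} hx hy a ha => by rw [map_mul, hx a ha, hy a ha]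
  inv_mem' := fun {x} hx a ha => by rw [map_inv, hx a ha]

theorem normal_sSup {S : Set (Subgroup G)} (h : ∀ H ∈ S, H.Normal) : (sSup S).Normal := by
  constructor
  intro n hn g
  have hmap : (sSup S).map (MulAut.conj g).toMonoidHom ≤ sSup S := by
    rw [(Subgroup.gc_map_comap (MulAut.conj g).toMonoidHom).l_sSup]
    refine iSup_le fun H => iSup_le fun hH => le_trans ?_ (le_sSup hH)
    rw [Subgroup.map_le_iff_le_comap]
    intro x hx
    exact (h H hH).conj_mem x hx g
  have hmem : (MulAut.conj g) n ∈ (sSup S).map (MulAut.conj g).toMonoidHom :=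
    ⟨n, hn, rfl⟩
  simpa [MulAut.conj_apply] using hmap hmem

/-- The Fitting subgroup: the largest nilpotent normal subgroup. -/
def fittingSubgroup (G : Type*) [Group G] : Subgroup G :=
  sSup {H : Subgroup G | H.Normal ∧ Group.IsNilpotent H}

instance fittingSubgroup_normal (G : Type*) [Group G] : (fittingSubgroup G).Normal :=
  normal_sSup fun _ hH => hH.1

/-- Any automorphism maps the Fitting subgroup into itself. -/
theorem fittingSubgroup_le_comap (e : MulAut G) :
    fittingSubgroup G ≤ (fittingSubgroup G).comap e.toMonoidHom := by
  rw [← Subgroup.map_le_iff_le_comap]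
  conv_rhs => rw [fittingSubgroup]
  rw [fittingSubgroup, (Subgroup.gc_map_comap e.toMonoidHom).l_sSup]
  refine iSup_le fun H => iSup_le fun hH => le_sSup ?_
  refine ⟨hH.1.map e.toMonoidHom e.surjective, ?_⟩
  haveI := hH.2
  exact nilpotent_of_surjective (e.toMonoidHom.subgroupMap H)
    (e.toMonoidHom.subgroupMap_surjective H)

/-- The Fitting series: `F_0 = 1`, `F_{k+1}` is the preimage in `G` of the Fitting
subgroup of `G/F_k`, bundled with proofs of normality. -/
def fittingSeriesAux (G : Type*) [Group G] : ℕ → {H : Subgroup G // H.Normal}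
  | 0 => ⟨⊥, inferInstance⟩
  | n + 1 =>
      haveI := (fittingSeriesAux G n).2
      ⟨(fittingSubgroup (G ⧸ (fittingSeriesAux G n).1)).comap
          (QuotientGroup.mk' (fittingSeriesAux G n).1),
        Subgroup.Normal.comap (fittingSubgroup_normal _) _⟩

/-- The Fitting series `F_n(G)`. -/
def fittingSeries (G : Type*) [Group G] (n : ℕ) : Subgroup G := (fittingSeriesAux G n).1

instance fittingSeries_normal (G : Type*) [Group G] (n : ℕ) : (fittingSeries G n).Normal :=
  (fittingSeriesAux G n).2

/-- The soluble radical `S(G)`: the largest soluble normal subgroup. -/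
def solubleRadical (G : Type*) [Group G] : Subgroup G :=
  sSup {H : Subgroup G | H.Normal ∧ IsSolvable H}

instance solubleRadical_normal (G : Type*) [Group G] : (solubleRadical G).Normal :=
  normal_sSup fun _ hH => hH.1

/-- The composition length of a finite soluble group: for such groups it equals the
number of prime factors of the order counted with multiplicity (all composition
factors are of prime order). -/
noncomputable def compLength (A : Type*) [Group A] : ℕ := (Nat.card A).primeFactorsList.length

/-- `[V, u] = ⟨v⁻¹ · u(v) : v ∈ V⟩` for an automorphism `u` of `V`. -/
def autCommutator {V : Type*} [Group V] (u : MulAut V) : Subgroup V :=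
  Subgroup.closure {x : V | ∃ v : V, x = v⁻¹ * u v}

/-- `O_{p'}(G)`: the largest normal subgroup of order coprime to `p`. -/
def Oprime (p : ℕ) (G : Type*) [Group G] : Subgroup G :=
  sSup {H : Subgroup G | H.Normal ∧ ¬ p ∣ Nat.card H}

instance Oprime_normal (p : ℕ) (G : Type*) [Group G] : (Oprime p G).Normal :=
  normal_sSup fun _ hH => hH.1

/-- `O_p(G)`: the largest normal `p`-subgroup. -/
def Osub (p : ℕ) (G : Type*) [Group G] : Subgroup G :=
  sSup {H : Subgroup G | H.Normal ∧ IsPGroup p H}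

instance Osub_normal (p : ℕ) (G : Type*) [Group G] : (Osub p G).Normal :=
  normal_sSup fun _ hH => hH.1

/-- `O_{p',p}(G)`: the preimage in `G` of `O_p(G/O_{p'}(G))`. -/
def OprimeP (p : ℕ) (G : Type*) [Group G] : Subgroup G :=
  (Osub p (G ⧸ Oprime p G)).comap (QuotientGroup.mk' (Oprime p G))

instance OprimeP_normal (p : ℕ) (G : Type*) [Group G] : (OprimeP p G).Normal :=
  Subgroup.Normal.comap (Osub_normal p _) _

end Defs
universe u

/-! ### Abstract linear part -/

/-- The Fitting one-component of an endomorphism. -/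
def evRange {V : Type*} [AddCommGroup V] (T : Module.End ℤ V) : Submodule ℤ V :=
  ⨅ n : ℕ, LinearMap.range (T ^ n)

lemma evRange_eq {V : Type*} [AddCommGroup V] [Finite V] (T : Module.End ℤ V) :
    ∃ n₀ : ℕ, ∀ n, n₀ ≤ n → evRange T = LinearMap.range (T ^ n) := by
  have : IsArtinian ℤ V := isArtinian_of_finite
  exact Filter.eventually_atTop.mp (LinearMap.eventually_iInf_range_pow_eq T)

lemma le_evRange {V : Type*} [AddCommGroup V] (T : Module.End ℤ V) (W : Submodule ℤ V)
    (h : W ≤ W.map T) : W ≤ evRange T := by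
  refine le_iInf fun n => ?_
  induction n with
  | zero => simp [Module.End.one_eq_id]
  | succ n ih =>
    intro w hw
    obtain ⟨v, hv, rfl⟩ := h hw
    obtain ⟨u, rfl⟩ := ih hv
    exact ⟨u, by rw [pow_succ']; rfl⟩

lemma evRange_le_map {V : Type*} [AddCommGroup V] [Finite V] (T : Module.End ℤ V) :
    evRange T ≤ (evRange T).map T := by
  obtain ⟨n, hn⟩ := evRange_eq T
  intro w hw
  rw [hn (n+1) (by omega)] at hw
  obtain ⟨u, rfl⟩ := hw
  refine ⟨(T ^ n) u, ?_, by rw [pow_succ']; rfl⟩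
  rw [SetLike.mem_coe, hn n le_rfl]; exact ⟨u, rfl⟩

lemma evRange_map_le {V : Type*} [AddCommGroup V] (T S : Module.End ℤ V) (h : Commute S T)
    {v : V} (hv : v ∈ evRange T) : S v ∈ evRange T := by
  rw [evRange, Submodule.mem_iInf] at hv ⊢
  intro n
  obtain ⟨u, rfl⟩ := hv n
  exact ⟨S u, by
    have := (h.pow_right n).eq
    exact (LinearMap.congr_fun this u).symm⟩

lemma evRange_inj {V : Type*} [AddCommGroup V] [Finite V] (T : Module.End ℤ V)
    {v : V} (hv : v ∈ evRange T) (h0 : T v = 0) : v = 0 := by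
  let f : evRange T → evRange T := fun w => ⟨T w, evRange_map_le T T (Commute.refl T) w.2⟩
  have hs : Function.Surjective f := by
    rintro ⟨w, hw⟩
    obtain ⟨u, hu, rfl⟩ := evRange_le_map T hw
    exact ⟨⟨u, hu⟩, rfl⟩
  have hi := Finite.injective_iff_surjective.mpr hs
  have : (⟨v, hv⟩ : evRange T) = 0 := hi (Subtype.ext (by simp [f, h0]))
  exact congrArg Subtype.val this

lemma evRange_inj_pow {V : Type*} [AddCommGroup V] [Finite V] (T : Module.End ℤ V) (n : ℕ)
    {v : V} (hv : v ∈ evRange T) (h0 : (T ^ n) v = 0) : v = 0 := by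
  induction n with
  | zero => simpa using h0
  | succ n ih =>
    apply ih
    apply evRange_inj T (evRange_map_le T _ ((Commute.refl T).pow_left n) hv)
    rw [pow_succ'] at h0; exact h0

lemma evRange_of_inj {V : Type*} [AddCommGroup V] [Finite V] (T : Module.End ℤ V)
    (W : Submodule ℤ V) (h1 : ∀ w ∈ W, T w ∈ W) (h2 : ∀ w ∈ W, T w = 0 → w = 0) :
    W ≤ evRange T := by
  apply le_evRange
  let f : W → W := fun w => ⟨T w, h1 w w.2⟩
  have hi : Function.Injective f := by
    intro a b hab
    have : T (a - b : V) = 0 := by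
      rw [map_sub, sub_eq_zero]; exact congrArg Subtype.val hab
    exact Subtype.ext (sub_eq_zero.mp (h2 _ (W.sub_mem a.2 b.2) this))
  intro w hw
  obtain ⟨u, hu⟩ := Finite.injective_iff_surjective.mp hi ⟨w, hw⟩
  exact ⟨u, u.2, congrArg Subtype.val hu⟩

/-- An abelian group acting with small Fitting one-components and without unipotent elements
is small. -/
lemma abelian_bound {B : Type*} [Group B] [Finite B] (hB : ∀ x y : B, x * y = y * x)
    {V : Type*} [AddCommGroup V] [Finite V] (ρ : B →* Module.End ℤ V) (m : ℕ)
    (hm : ∀ b, Nat.card (evRange (ρ b - 1)) ≤ m)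
    (hu : ∀ b, IsNilpotent (ρ b - 1) → b = 1) : Nat.card B ≤ m.factorial := by
  classical
  obtain ⟨b, hb⟩ := Finite.exists_max (fun b : B => Nat.card (evRange (ρ b - 1)))
  have hcomm : ∀ x y : B, Commute (ρ x) (ρ y) := fun x y => by
    show ρ x * ρ y = ρ y * ρ x
    rw [← map_mul, ← map_mul, hB]
  have hcomm1 : ∀ x y : B, Commute (ρ x) (ρ y - 1) := fun x y =>
    (hcomm x y).sub_right (Commute.one_right _)
  have hcomm2 : ∀ x y : B, Commute (ρ x - 1) (ρ y - 1) := fun x y =>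
    (hcomm1 x y).sub_left (Commute.one_left _)
  have hinvb : ∀ (x : B) (v : V), ρ x⁻¹ (ρ x v) = v := fun x v => by
    rw [← Module.End.mul_apply, ← map_mul]; simp
  -- key
  have key : ∀ k : B, (∀ v ∈ evRange (ρ b - 1), ρ k v = v) → k = 1 := by
    intro k hk
    have hdisj : ∀ v, v ∈ evRange (ρ b - 1) → v ∈ evRange (ρ k - 1) → v = 0 := by
      intro v h1 h2
      apply evRange_inj _ h2
      simp [hk v h1]
    have h1 : evRange (ρ b - 1) ≤ evRange (ρ (b * k) - 1) := by
      have he : ∀ w ∈ evRange (ρ b - 1), (ρ (b * k) - 1) w = (ρ b - 1) w := by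
        intro w hw
        simp [map_mul, hk w hw]
      apply evRange_of_inj
      · intro w hw
        rw [he w hw]
        exact evRange_map_le _ _ (Commute.refl _) hw
      · intro w hw h
        rw [he w hw] at h
        exact evRange_inj _ hw h
    have h2 : evRange (ρ k - 1) ≤ evRange (ρ (b * k) - 1) := by
      apply evRange_of_inj
      · intro w hw
        exact evRange_map_le _ _ (hcomm2 _ _) hw
      · intro w hw h
        obtain ⟨n, hn⟩ := evRange_eq (ρ b - 1)
        have hbn : ((ρ b - 1) ^ n) w = 0 := by
          apply hdisj
          · rw [hn n le_rfl]; exact ⟨w, rfl⟩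
          · exact evRange_map_le _ _ ((hcomm2 _ _).pow_left n) hw
        have hstep : ∀ i : ℕ, ((ρ k - 1) ^ i) (((ρ b) ^ i) w) = ((-1) ^ i : ℤ) • ((ρ b - 1) ^ i) w := by
          have h0 : (ρ k - 1) (ρ b w) = - (ρ b - 1) w := by
            have : (ρ (b * k) - 1) w = (ρ b - 1) w + (ρ k - 1) (ρ b w) := by
              have hbk : ρ (b * k) w = ρ k (ρ b w) := by rw [hB, map_mul]; rfl
              rw [LinearMap.sub_apply, LinearMap.sub_apply, LinearMap.sub_apply, hbk]
              simp
            rw [h] at this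
            exact (neg_eq_of_add_eq_zero_right this.symm).symm
          intro i
          induction i with
          | zero => simp
          | succ i ih =>
            have e1 : ((ρ k - 1) ^ (i+1)) (((ρ b) ^ (i+1)) w)
                = ((ρ k - 1) * (ρ b)) (((ρ k - 1) ^ i) (((ρ b) ^ i) w)) := by
              rw [← Module.End.mul_apply, ← Module.End.mul_apply, ← Module.End.mul_apply]
              have hc := ((hcomm1 b k).pow_right i).eq
              have : (ρ k - 1) ^ (i+1) * (ρ b) ^ (i+1)
                  = (ρ k - 1) * ρ b * ((ρ k - 1) ^ i * (ρ b) ^ i) := by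
                rw [pow_succ', pow_succ', mul_assoc, mul_assoc, ← mul_assoc (ρ b), hc, mul_assoc]
              rw [this]
              simp only [mul_assoc]
            have e2 : ((ρ k - 1) * (ρ b)) (((ρ b - 1) ^ i) w)
                = ((ρ b - 1) ^ i) ((ρ k - 1) (ρ b w)) := by
              have := (((hcomm2 k b).mul_left (hcomm1 b b)).pow_right i).eq
              have := LinearMap.congr_fun this w
              exact this
            rw [e1, ih, map_zsmul, e2, h0, map_neg]
            rw [pow_succ (-1 : ℤ), pow_succ (ρ b - 1)]
            rw [Module.End.mul_apply, mul_neg_one, smul_neg, neg_smul]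
        have h3 : ((ρ k - 1) ^ n) (((ρ b) ^ n) w) = 0 := by rw [hstep, hbn, smul_zero]
        have h4 : ((ρ b) ^ n) w = 0 :=
          evRange_inj_pow _ n (evRange_map_le _ _ ((hcomm1 b k).pow_left n) hw) h3
        rw [← map_pow] at h4
        rw [← hinvb (b ^ n) w, h4, map_zero]
    -- maximality
    have heq : evRange (ρ b - 1) = evRange (ρ (b * k) - 1) := by
      apply SetLike.coe_injective
      apply Set.eq_of_subset_of_ncard_le h1 _ (Set.toFinite _)
      exact hb (b * k)
    have hbot : evRange (ρ k - 1) = ⊥ := by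
      rw [eq_bot_iff]
      intro v hv
      exact hdisj v (heq ▸ h2 hv) hv
    apply hu
    obtain ⟨n, hn⟩ := evRange_eq (ρ k - 1)
    refine ⟨n, ?_⟩
    rw [← LinearMap.range_eq_bot, ← hn n le_rfl, hbot]
  let W := evRange (ρ b - 1)
  let f : B → Equiv.Perm W := fun k =>
    { toFun := fun w => ⟨ρ k w, evRange_map_le _ _ (hcomm1 _ _) w.2⟩
      invFun := fun w => ⟨ρ k⁻¹ w, evRange_map_le _ _ (hcomm1 _ _) w.2⟩
      left_inv := fun w => Subtype.ext (hinvb k w)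
      right_inv := fun w => Subtype.ext (by have := hinvb k⁻¹ w; rwa [inv_inv] at this) }
  have hf : Function.Injective f := by
    intro x y hxy
    have : y⁻¹ * x = 1 := by
      apply key
      intro v hv
      have h1 : ρ x v = ρ y v :=
        congrArg Subtype.val (Equiv.congr_fun hxy ⟨v, hv⟩)
      rw [map_mul, Module.End.mul_apply, h1, hinvb]
    exact (inv_mul_eq_one.mp this).symm
  calc Nat.card B ≤ Nat.card (Equiv.Perm W) := Nat.card_le_card_of_injective f hf
    _ = (Nat.card W).factorial := Nat.card_perm
    _ ≤ m.factorial := Nat.factorial_le (hm b)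

/-- In a nilpotent group, a normal subgroup not contained in a normal subgroup `B` has an element
outside `B` which is central modulo `B`. -/
lemma exists_central_mod {D : Type*} [Group D] [Group.IsNilpotent D] (N B : Subgroup D)
    [N.Normal] (h : ¬ N ≤ B) : ∃ x ∈ N, x ∉ B ∧ ∀ g, x * g * x⁻¹ * g⁻¹ ∈ B := by
  by_contra! hc
  apply h
  have : ∀ n, N ⊓ Subgroup.upperCentralSeries D n ≤ B := by
    intro n
    induction n with
    | zero => 
      intro x hx
      have : x = 1 := by simpa using hx.2
      rw [this]; exact B.one_mem
    | succ n ih =>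
      rintro x ⟨hx, hx2⟩
      by_contra hxB
      obtain ⟨g, hg⟩ := hc x hx hxB
      apply hg
      apply ih
      refine ⟨?_, Subgroup.mem_upperCentralSeries_succ_iff.mp hx2 g⟩
      have : x * g * x⁻¹ * g⁻¹ = x * (g * x⁻¹ * g⁻¹) := by group
      rw [this]
      exact N.mul_mem hx (Subgroup.Normal.conj_mem inferInstance _ (N.inv_mem hx) g)
  have h2 := this (Group.nilpotencyClass D)
  rwa [Subgroup.upperCentralSeries_nilpotencyClass, inf_top_eq] at h2

lemma nilpotent_bound {D : Type*} [Group D] [Finite D] [Group.IsNilpotent D] (n : ℕ)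
    (h : ∀ B : Subgroup D, (∀ x ∈ B, ∀ y ∈ B, x * y = y * x) → Nat.card B ≤ n) :
    Nat.card D ≤ n * n.factorial := by
  classical
  have hex : ∃ B : Subgroup D, Maximal
      (fun B : Subgroup D => B.Normal ∧ ∀ x ∈ B, ∀ y ∈ B, x * y = y * x) B := by
    apply Set.Finite.exists_maximal (Set.toFinite _)
    exact ⟨⊥, inferInstance, by simp⟩
  obtain ⟨B, ⟨hBn, hBc⟩, hmax⟩ := hex
  have hcent : Subgroup.centralizer (B : Set D) ≤ B := by
    by_contra hc
    obtain ⟨x, hx, hxB, hxc⟩ := exists_central_mod (Subgroup.centralizer (B : Set D)) B hc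
    rw [Subgroup.mem_centralizer_iff] at hx
    let K := Subgroup.closure ((B : Set D) ∪ {x})
    have hBK : B ≤ K := fun y hy => Subgroup.subset_closure (Or.inl hy)
    have hxK : x ∈ K := Subgroup.subset_closure (Or.inr rfl)
    have hKn : K.Normal := by
      refine ⟨fun k hk g => ?_⟩
      induction hk using Subgroup.closure_induction with
      | mem y hy =>
        rcases hy with hy | hy
        · exact hBK (hBn.conj_mem y hy g)
        · rw [Set.mem_singleton_iff] at hy
          subst hy
          have := hxc g
          have e : g * y * g⁻¹ = (y * g * y⁻¹ * g⁻¹)⁻¹ * y := by group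
          rw [e]
          exact K.mul_mem (K.inv_mem (hBK this)) hxK
      | one => simp
      | mul a b _ _ ha hb =>
        have e : g * (a * b) * g⁻¹ = (g * a * g⁻¹) * (g * b * g⁻¹) := by group
        rw [e]; exact K.mul_mem ha hb
      | inv a _ ha =>
        have e : g * a⁻¹ * g⁻¹ = (g * a * g⁻¹)⁻¹ := by group
        rw [e]; exact K.inv_mem ha
    have hKc : ∀ a ∈ K, ∀ b ∈ K, a * b = b * a := by
      have hset : ∀ a ∈ (B : Set D) ∪ {x}, ∀ b ∈ (B : Set D) ∪ {x}, a * b = b * a := by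
        rintro a (ha | rfl) b (hb | rfl)
        · exact hBc a ha b hb
        · exact hx a ha
        · exact (hx b hb).symm
        · rfl
      have := Subgroup.isMulCommutative_closure (k := (B : Set D) ∪ {x}) hset
      intro a ha b hb
      exact congrArg Subtype.val (mul_comm' (⟨a, ha⟩ : K) ⟨b, hb⟩)
    exact hxB (hmax ⟨hKn, hKc⟩ hBK hxK)
  have hker : (MulAut.conjNormal (H := B)).ker ≤ B := by
    intro x hx
    apply hcent
    rw [Subgroup.mem_centralizer_iff]
    intro y hy
    have h1 := congrArg Subtype.val (MulEquiv.congr_fun (MonoidHom.mem_ker.mp hx) ⟨y, hy⟩)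
    rw [MulAut.conjNormal_apply] at h1
    simp only [MulAut.one_apply] at h1
    exact (mul_inv_eq_iff_eq_mul.mp h1).symm
  have hi : (MulAut.conjNormal (H := B)).ker.index ≤ n.factorial := by
    rw [Subgroup.index_ker]
    calc Nat.card (MulAut.conjNormal (H := B)).range ≤ Nat.card (MulAut B) :=
          Nat.card_le_card_of_injective _ Subtype.val_injective
      _ ≤ Nat.card (Equiv.Perm B) :=
          Nat.card_le_card_of_injective (fun e => e.toEquiv) (fun a b h => MulEquiv.ext fun x => Equiv.congr_fun h x)
      _ = (Nat.card B).factorial := Nat.card_perm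
      _ ≤ n.factorial := Nat.factorial_le (h B hBc)
  rw [← Subgroup.card_mul_index (MulAut.conjNormal (H := B)).ker]
  exact Nat.mul_le_mul ((Nat.card_le_card_of_injective _ (Subgroup.inclusion_injective hker)).trans (h B hBc)) hi

/-! ### Group-theoretic part -/

open scoped commutatorElement

lemma Osub_isPGroup (p : ℕ) [Fact p.Prime] (G : Type*) [Group G] [Finite G] :
    IsPGroup p (Osub p G) :=
  Sylow.sSup_of_normal _ (fun _ h => h.2) (fun _ h => h.1)

lemma fitting_le_iSup (G : Type*) [Group G] [Finite G] :
    fittingSubgroup G ≤ ⨆ p : (Nat.card G).primeFactors, Osub p G := by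
  refine sSup_le ?_
  rintro H ⟨hHn, hHnil⟩
  set E := ⨆ p : (Nat.card G).primeFactors, Osub p G with hE
  rw [← Subgroup.subgroupOf_eq_top, ← Subgroup.index_eq_one]
  by_contra hne
  obtain ⟨p, hp, hpd⟩ := Nat.exists_prime_and_dvd hne
  have : Fact p.Prime := ⟨hp⟩
  obtain ⟨P⟩ : Nonempty (Sylow p H) := inferInstance
  have hPn : (P : Subgroup H).Normal := inferInstance
  have hPc : (P : Subgroup H).Characteristic := P.characteristic_of_normal hPn
  have hpG : p ∈ (Nat.card G).primeFactors := by
    rw [Nat.mem_primeFactors]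
    refine ⟨hp, ?_, Nat.card_pos.ne'⟩
    exact hpd.trans ((Subgroup.index_dvd_card _).trans (Subgroup.card_subgroup_dvd_card H))
  have hle : (P : Subgroup H) ≤ E.subgroupOf H := by
    rw [Subgroup.subgroupOf, ← Subgroup.map_le_iff_le_comap]
    have h1 : (P : Subgroup H).map H.subtype ≤ Osub p G := by
      apply le_sSup
      refine ⟨inferInstance, P.isPGroup'.map _⟩
    exact h1.trans (le_iSup (fun q : (Nat.card G).primeFactors => Osub q G) ⟨p, hpG⟩)
  exact P.not_dvd_index (hpd.trans (Subgroup.index_dvd_of_le hle))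

instance fitting_nilpotent (G : Type*) [Group G] [Finite G] :
    Group.IsNilpotent (fittingSubgroup G) := by
  classical
  have hfact : ∀ p : (Nat.card G).primeFactors, Fact (p : ℕ).Prime := fun p =>
    ⟨Nat.prime_of_mem_primeFactors p.2⟩
  have hcomm : Pairwise fun i j : (Nat.card G).primeFactors =>
      ∀ x y : G, x ∈ Osub i G → y ∈ Osub j G → Commute x y := by
    intro i j hij x y hx hy
    refine Subgroup.commute_of_normal_of_disjoint _ _ (Osub_normal i G) (Osub_normal j G) ?_ x y hx hy
    exact IsPGroup.disjoint_of_ne i j (fun h => hij (Subtype.ext h)) _ _ (Osub_isPGroup _ G) (Osub_isPGroup _ G)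
  have hnil : ∀ i : (Nat.card G).primeFactors, Group.IsNilpotent (Osub (i : ℕ) G) := fun i =>
    (Osub_isPGroup _ G).isNilpotent
  have h1 : Group.IsNilpotent (Subgroup.noncommPiCoprod hcomm).range :=
    Group.nilpotent_of_surjective _ (MonoidHom.rangeRestrict_surjective (Subgroup.noncommPiCoprod hcomm))
  rw [Subgroup.noncommPiCoprod_range] at h1
  exact Group.nilpotent_of_mulEquiv (Subgroup.subgroupOfEquivOfLe (fitting_le_iSup G))

lemma le_fitting {G : Type*} [Group G] (K : Subgroup G) (h1 : K.Normal)
    (h2 : Group.IsNilpotent K) : K ≤ fittingSubgroup G := le_sSup ⟨h1, h2⟩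

/-- If `G/F(G)` is nilpotent, nilpotent subgroups containing `F(G)` equal `F(G)`. -/
lemma nilpotent_le_fitting {G : Type*} [Group G] [Finite G]
    (hq : Group.IsNilpotent (G ⧸ fittingSubgroup G)) (K : Subgroup G)
    (hF : fittingSubgroup G ≤ K) (hK : Group.IsNilpotent K) : K ≤ fittingSubgroup G := by
  have hex : ∃ L : Subgroup G, K ≤ L ∧ Maximal
      (fun B : Subgroup G => Group.IsNilpotent B) L :=
    Set.Finite.exists_le_maximal (Set.toFinite _) hK
  obtain ⟨L, hKL, hLn, hmax⟩ := hex
  refine hKL.trans (le_fitting L ?_ hLn)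
  set N : Subgroup G := Subgroup.normalizer (L : Set G) with hN
  have hLN : L ≤ N := Subgroup.le_normalizer
  -- the Fitting subgroup of N is L
  have hfit : (fittingSubgroup N).map N.subtype = L := by
    have hle : L ≤ (fittingSubgroup N).map N.subtype := by
      have h1 : L.subgroupOf N ≤ fittingSubgroup N :=
        le_fitting _ (Subgroup.normal_in_normalizer)
          (Group.nilpotent_of_mulEquiv (Subgroup.subgroupOfEquivOfLe hLN).symm)
      have h2 := Subgroup.map_mono (f := N.subtype) h1
      rwa [Subgroup.map_subgroupOf_eq_of_le hLN] at h2
    refine le_antisymm (hmax ?_ hle) hle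
    exact Group.nilpotent_of_mulEquiv
      (Subgroup.equivMapOfInjective (fittingSubgroup N) N.subtype N.subtype_injective)
  have hNN : Subgroup.normalizer (N : Set G) ≤ N := by
    intro x hx
    have hconj : ∀ y ∈ Subgroup.normalizer (N : Set G), ∀ l ∈ L, y * l * y⁻¹ ∈ L := by
      intro y hy l hl
      rw [← hfit] at hl
      obtain ⟨l, hl, rfl⟩ := hl
      have hyN : ∀ n, n ∈ N ↔ y * n * y⁻¹ ∈ N := fun n => Subgroup.mem_normalizer_iff.mp hy n
      let e : MulAut N :=
        { toFun := fun n => ⟨y * n * y⁻¹, (hyN n).mp n.2⟩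
          invFun := fun n => ⟨y⁻¹ * n * y, (hyN _).mpr (by
            have : y * (y⁻¹ * n * y) * y⁻¹ = (n : G) := by group
            rw [this]; exact n.2)⟩
          left_inv := fun n => Subtype.ext (by simp [mul_assoc])
          right_inv := fun n => Subtype.ext (by simp [mul_assoc])
          map_mul' := fun a b => Subtype.ext (by simp [mul_assoc]) }
      rw [← hfit]
      exact ⟨e l, fittingSubgroup_le_comap e hl, rfl⟩
    rw [hN, Subgroup.mem_normalizer_iff]
    intro l
    refine ⟨hconj x hx l, fun h => ?_⟩
    have := hconj x⁻¹ (Subgroup.inv_mem _ hx) _ h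
    have e : x⁻¹ * (x * l * x⁻¹) * x⁻¹⁻¹ = l := by group
    rwa [e] at this
  have hNtop : N = ⊤ := by
    set π := QuotientGroup.mk' (fittingSubgroup G)
    have hker : π.ker ≤ N := by
      rw [QuotientGroup.ker_mk']; exact hF.trans (hKL.trans hLN)
    have hc : (N.map π).comap π = N := Subgroup.comap_map_eq_self hker
    have hself : Subgroup.normalizer ((N.map π : Subgroup _) : Set _) = N.map π := by
      apply Subgroup.comap_injective (QuotientGroup.mk'_surjective (fittingSubgroup G))
      rw [Subgroup.comap_normalizer_eq_of_surjective _ (QuotientGroup.mk'_surjective _)]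
      show Subgroup.normalizer (((N.map π).comap π : Subgroup G) : Set G) = (N.map π).comap π
      rw [hc]
      exact le_antisymm hNN Subgroup.le_normalizer
    have hnc := Group.normalizerCondition_of_isNilpotent (G := G ⧸ fittingSubgroup G)
    rw [normalizerCondition_iff_only_full_group_self_normalizing] at hnc
    have := hnc _ hself
    rw [← hc, this, Subgroup.comap_top]
  exact Subgroup.normalizer_eq_top_iff.mp hNtop

/-- In a finite nilpotent group the derived subgroup is contained in all maximal subgroups. -/
lemma sup_commutator_eq_top {F : Type*} [Group F] [Finite F] [Group.IsNilpotent F]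
    (K : Subgroup F) (h : K ⊔ commutator F = ⊤) : K = ⊤ := by
  by_contra hK
  obtain ⟨L, hL, hKL⟩ := (eq_top_or_exists_le_coatom K).resolve_left hK
  have hLn : L.Normal := Subgroup.NormalizerCondition.normal_of_coatom L
    Group.normalizerCondition_of_isNilpotent hL
  obtain ⟨x, -, hxL, hxc⟩ := exists_central_mod (⊤ : Subgroup F) L (fun h => hL.1 (top_le_iff.mp h))
  have hcL : commutator F ≤ L := by
    have htop : L ⊔ Subgroup.zpowers x = ⊤ := by
      apply hL.2
      refine lt_of_le_of_ne le_sup_left fun h => hxL ?_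
      rw [h]; exact Subgroup.mem_sup_right (Subgroup.mem_zpowers x)
    exact Subgroup.Normal.commutator_le_of_self_sup_commutative_eq_top htop inferInstance
  exact hL.1 (top_le_iff.mp (h ▸ sup_le hKL hcL))

lemma hall_aux {H : Type*} [Group H] (F : Subgroup H) (g : H)
    (htop : F ⊔ Subgroup.zpowers g = ⊤) (M W : Subgroup H) (hM : IsCoatom M) (hW : W.Normal)
    (hWM : W ≤ M) (y : H) (hy : y ∉ M) (hyg : gComm y g ∈ W)
    (hyF : ∀ f ∈ F, gComm y f ∈ W) : M.Normal := by
  have hc : ∀ h : H, gComm y h ∈ W := by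
    have key : ∀ h, gComm y h ∈ W ↔
        h ∈ (Subgroup.centralizer {(QuotientGroup.mk' W y)}).comap (QuotientGroup.mk' W) := by
      intro h
      rw [Subgroup.mem_comap, Subgroup.mem_centralizer_singleton_iff, ← map_mul, ← map_mul]
      show _ ↔ ((h * y : H) : H ⧸ W) = ((y * h : H) : H ⧸ W)
      rw [QuotientGroup.eq, gComm]
      have : (h * y)⁻¹ * (y * h) = y⁻¹ * h⁻¹ * y * h := by group
      rw [this]
    intro h
    rw [key]
    have hle : F ⊔ Subgroup.zpowers g ≤
        (Subgroup.centralizer {(QuotientGroup.mk' W y)}).comap (QuotientGroup.mk' W) := by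
      refine sup_le (fun f hf => (key f).mp (hyF f hf)) ?_
      rw [Subgroup.zpowers_le]
      exact (key g).mp hyg
    exact hle (htop ▸ Subgroup.mem_top h)
  rw [← Subgroup.normalizer_eq_top_iff]
  apply hM.2
  refine lt_of_le_of_ne Subgroup.le_normalizer fun h => hy ?_
  rw [h]
  rw [Subgroup.mem_normalizer_iff]
  intro n
  have e : y * n * y⁻¹ = (y * (gComm y n⁻¹)⁻¹ * y⁻¹) * n := by simp [gComm, mul_assoc]
  rw [e]
  exact (M.mul_mem_cancel_left (hWM (hW.conj_mem _ (W.inv_mem (hc _)) y))).symm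

/-- A version of the Hall nilpotency criterion. -/
lemma hall_crit {H : Type*} [Group H] [Finite H] (F : Subgroup H) [hFn : F.Normal]
    [hF : Group.IsNilpotent F] (g : H) (htop : F ⊔ Subgroup.zpowers g = ⊤)
    (hg : ∀ f ∈ F, ∃ n, engel f g n ∈ ⁅F, F⁆) : Group.IsNilpotent H := by
  apply (Group.isNilpotent_of_finite_tfae (G := H)).out 2 0 |>.mp
  intro M hM
  by_cases hFM : F ≤ M
  · have hgM : g ∉ M := fun h => hM.1 (top_le_iff.mp (htop ▸ sup_le hFM (by simpa using h)))
    refine hall_aux F g htop M F hM hFn hFM g hgM (by simp [gComm]) fun f hf => ?_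
    have e : gComm g f = (g⁻¹ * f⁻¹ * g⁻¹⁻¹) * f := by simp [gComm]
    rw [e]; exact F.mul_mem (hFn.conj_mem _ (F.inv_mem hf) _) hf
  have hMF : M ⊔ F = ⊤ := by
    apply hM.2
    exact lt_of_le_of_ne le_sup_left fun h => hFM (h ▸ le_sup_right)
  have hder : ⁅F, F⁆ ≤ M := by
    by_contra hc
    have hMF' : M ⊔ ⁅F, F⁆ = ⊤ := by
      apply hM.2
      exact lt_of_le_of_ne le_sup_left fun h => hc (h ▸ le_sup_right)
    apply hFM
    have h1 : M.subgroupOf F ⊔ commutator F = ⊤ := by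
      rw [eq_top_iff]
      rintro ⟨f, hf⟩ -
      have : f ∈ M ⊔ ⁅F, F⁆ := hMF' ▸ Subgroup.mem_top f
      rw [Subgroup.mem_sup_of_normal_right] at this
      obtain ⟨a, ha, b, hb, rfl⟩ := this
      have hbF : b ∈ F := Subgroup.commutator_le_self F hb
      have haF : a ∈ F := by simpa using F.mul_mem hf (F.inv_mem hbF)
      have : (⟨a * b, hf⟩ : F) = ⟨a, haF⟩ * ⟨b, hbF⟩ := rfl
      rw [this]
      refine Subgroup.mul_mem_sup ha ?_
      rw [← Subgroup.map_subtype_commutator] at hb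
      obtain ⟨c, hc, hcb⟩ := hb
      have : c = ⟨b, hbF⟩ := Subtype.ext hcb
      rwa [← this]
    have := sup_commutator_eq_top _ h1
    rwa [Subgroup.subgroupOf_eq_top] at this
  have hWn : (M ⊓ F).Normal := by
    rw [← Subgroup.normalizer_eq_top_iff, eq_top_iff, ← hMF]
    refine sup_le ?_ ?_
    · rw [Subgroup.le_normalizer_iff]
      intro h hh k hk
      exact ⟨M.mul_mem (M.mul_mem hh hk.1) (M.inv_mem hh), hFn.conj_mem _ hk.2 _⟩
    · rw [Subgroup.le_normalizer_iff]
      intro h hh k hk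
      have e : h * k * h⁻¹ = ⁅h, k⁆ * k := by simp [commutatorElement_def]
      refine ⟨?_, hFn.conj_mem _ hk.2 _⟩
      rw [e]
      exact M.mul_mem (hder (Subgroup.commutator_mem_commutator hh hk.2)) hk.1
  obtain ⟨f, hf, hfM⟩ := Set.not_subset.mp hFM
  have hengF : ∀ n, engel f g n ∈ F := by
    intro n
    induction n with
    | zero => exact hf
    | succ n ih =>
      show (engel f g n)⁻¹ * g⁻¹ * (engel f g n) * g ∈ F
      have e : (engel f g n)⁻¹ * g⁻¹ * (engel f g n) * g
          = (engel f g n)⁻¹ * (g⁻¹ * (engel f g n) * g⁻¹⁻¹) := by group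
      rw [e]
      exact F.mul_mem (F.inv_mem ih) (hFn.conj_mem _ ih _)
  obtain ⟨j, hj1, hj2⟩ : ∃ j, engel f g j ∉ M ∧ engel f g (j+1) ∈ M := by
    by_contra! hc
    obtain ⟨n, hn⟩ := hg f hf
    have : ∀ n, engel f g n ∉ M := by
      intro n
      induction n with
      | zero => exact hfM
      | succ n ih => exact hc n ih
    exact this n (hder hn)
  refine hall_aux F g htop M (M ⊓ F) hM hWn inf_le_left (engel f g j) hj1 ⟨hj2, hengF (j+1)⟩
    fun f' hf' => ?_
  have e : gComm (engel f g j) f' = ⁅(engel f g j)⁻¹, f'⁻¹⁆ := by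
    simp [gComm, commutatorElement_def]
  rw [e]
  have := Subgroup.commutator_mem_commutator (F.inv_mem (hengF j)) (F.inv_mem hf')
  exact ⟨hder this, Subgroup.commutator_le_self F this⟩

/-! ### Coprime action -/

lemma coprime_lift {G : Type*} [Group G] [Finite G] (A : Subgroup (MulAut G))
    (hA : (Nat.card A).Coprime (Nat.card G)) (N : Subgroup G) (hN : Group.IsSolvable N)
    (hinv : ∀ a ∈ A, ∀ n ∈ N, a n ∈ N) (g : G) (hg : ∀ a ∈ A, g⁻¹ * a g ∈ N) :
    ∃ n ∈ N, g * n ∈ fixedSubgroup A := by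
  classical
  induction N using WellFoundedLT.induction generalizing g with
  | ind N ih =>
  rcases subsingleton_or_nontrivial N with hs | hnt
  · refine ⟨1, N.one_mem, fun a ha => ?_⟩
    have : g⁻¹ * a g = 1 := congrArg N.subtype (hs.elim (⟨_, hg a ha⟩ : N) 1)
    rw [mul_one]
    exact (inv_mul_eq_one.mp this).symm
  have hlt : ⁅N, N⁆ < N := by
    have h1 := Group.IsSolvable.commutator_lt_top_of_nontrivial N
    rw [← Subgroup.map_subtype_commutator]
    have h2 := (Subgroup.map_lt_map_iff_of_injective N.subtype_injective).mpr h1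
    rwa [← MonoidHom.range_eq_map, N.range_subtype] at h2
  let r : A → (N →* N) := fun a =>
    { toFun := fun n => ⟨(a : MulAut G) n, hinv a a.2 n n.2⟩
      map_one' := Subtype.ext (by simp)
      map_mul' := fun x y => Subtype.ext (by simp) }
  let α : A → (Abelianization N →* Abelianization N) := fun a => Abelianization.map (r a)
  let c : A → N := fun a => ⟨g⁻¹ * (a : MulAut G) g, hg a a.2⟩
  let cV : A → Abelianization N := fun a => Abelianization.of (c a)
  have hcoc : ∀ a b : A, cV (a * b) = cV a * α a (cV b) := by
    intro a b
    show Abelianization.of (c (a * b)) = Abelianization.of (c a) * Abelianization.of (r a (c b))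
    rw [← map_mul]
    congr 1
    apply Subtype.ext
    simp [c, r, mul_assoc]
  have : Fintype A := Fintype.ofFinite A
  let P : Abelianization N := ∏ b : A, cV b
  have hP : ∀ a : A, (cV a) ^ (Nat.card A) * α a P = P := by
    intro a
    have h1 : ∏ b : A, cV (a * b) = P :=
      Fintype.prod_equiv (Equiv.mulLeft a) _ _ (fun _ => rfl)
    refine Eq.trans ?_ h1
    rw [Finset.prod_congr rfl (fun b _ => hcoc a b), Finset.prod_mul_distrib, Finset.prod_const,
      Finset.card_univ, ← Nat.card_eq_fintype_card, ← map_prod]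
  have hcop : (Nat.card (Abelianization N)).Coprime (Nat.card A) := by
    apply Nat.Coprime.symm
    apply Nat.Coprime.coprime_dvd_right _ hA
    refine dvd_trans ?_ (Subgroup.card_subgroup_dvd_card N)
    exact Subgroup.card_quotient_dvd_card (commutator N)
  obtain ⟨v, hv⟩ := (powCoprime hcop).surjective P
  have hv' : v ^ (Nat.card A) = P := hv
  obtain ⟨n, rfl⟩ : ∃ n : N, Abelianization.of n = v := QuotientGroup.mk_surjective v
  have hkey : ∀ a : A, cV a * α a (Abelianization.of n) = Abelianization.of n := by
    intro a
    apply (powCoprime hcop).injective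
    show (cV a * α a (Abelianization.of n)) ^ (Nat.card A) = (Abelianization.of n) ^ (Nat.card A)
    rw [mul_pow, ← map_pow (α a), hv', hP]
  have hmem : ∀ a ∈ A, (g * n)⁻¹ * a (g * n) ∈ ⁅N, N⁆ := by
    intro a ha
    have h1 := hkey ⟨a, ha⟩
    have h2 : n⁻¹ * (c ⟨a, ha⟩ * r ⟨a, ha⟩ n) ∈ commutator N := by
      rw [← Abelianization.ker_of, MonoidHom.mem_ker, map_mul, map_inv, map_mul, inv_mul_eq_one]
      exact h1.symm
    rw [← Subgroup.map_subtype_commutator]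
    refine ⟨_, h2, ?_⟩
    simp [c, r, mul_assoc]
  obtain ⟨n', hn', hfix⟩ := ih ⁅N, N⁆ hlt
    (Group.isSolvable_of_isSolvable_injective (Subgroup.inclusion_injective hlt.le))
    (by
      intro a ha n hn
      have h1 : (⁅N, N⁆).map a.toMonoidHom ≤ ⁅N, N⁆ := by
        rw [Subgroup.map_commutator]
        have : N.map a.toMonoidHom ≤ N := by
          rintro _ ⟨x, hx, rfl⟩; exact hinv a ha x hx
        exact Subgroup.commutator_mono this this
      exact h1 ⟨n, hn, rfl⟩) (g * n) hmem
  exact ⟨n * n', N.mul_mem n.2 (hlt.le hn'), by rwa [← mul_assoc]⟩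

/-! ### The conjugation representation on the abelianization of a normal subgroup -/

/-- The conjugation action on the abelianization of a normal subgroup. -/
def conjRep {G : Type*} [Group G] (F : Subgroup G) [F.Normal] :
    G →* Module.End ℤ (Additive (Abelianization F)) where
  toFun g := (MonoidHom.toAdditive
    (Abelianization.map (MulAut.conjNormal (H := F) g).toMonoidHom)).toIntLinearMap
  map_one' := by
    ext x
    obtain ⟨f, hf⟩ := QuotientGroup.mk_surjective x.toMul
    have : x = Additive.ofMul (Abelianization.of f) := hf.symm
    subst this
    show Additive.ofMul (Abelianization.of (MulAut.conjNormal (1 : G) f)) = _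
    rw [map_one]; rfl
  map_mul' g h := by
    ext x
    obtain ⟨f, hf⟩ := QuotientGroup.mk_surjective x.toMul
    have : x = Additive.ofMul (Abelianization.of f) := hf.symm
    subst this
    show Additive.ofMul (Abelianization.of (MulAut.conjNormal (g * h) f)) = _
    rw [map_mul]; rfl

/-- The projection of a subgroup to its abelianization. -/
def toAb {G : Type*} [Group G] {F : Subgroup G} (f : F) : Additive (Abelianization F) :=
  Additive.ofMul (Abelianization.of f)

lemma toAb_surj {G : Type*} [Group G] {F : Subgroup G} (v : Additive (Abelianization F)) :
    ∃ f : F, toAb f = v := QuotientGroup.mk_surjective v.toMul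

lemma toAb_mul {G : Type*} [Group G] {F : Subgroup G} (a b : F) :
    toAb (a * b) = toAb a + toAb b := rfl

lemma toAb_inv {G : Type*} [Group G] {F : Subgroup G} (a : F) :
    toAb a⁻¹ = - toAb a := rfl

lemma toAb_eq_zero {G : Type*} [Group G] {F : Subgroup G} (a : F) (h : toAb a = 0) :
    (a : G) ∈ ⁅F, F⁆ := by
  rw [← Subgroup.map_subtype_commutator]
  refine ⟨a, ?_, rfl⟩
  rw [SetLike.mem_coe, ← Abelianization.ker_of, MonoidHom.mem_ker]
  exact h

lemma conjRep_toAb {G : Type*} [Group G] (F : Subgroup G) [F.Normal] (g : G) (f : F) :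
    conjRep F g (toAb f) = toAb (MulAut.conjNormal g f) := rfl

lemma conjRep_eq_one {G : Type*} [Group G] (F : Subgroup G) [F.Normal] (g : G) (hg : g ∈ F) :
    conjRep F g = 1 := by
  ext v
  obtain ⟨f, rfl⟩ := toAb_surj v
  rw [conjRep_toAb]
  have : MulAut.conjNormal g f = (⟨g, hg⟩ : F) * f * (⟨g, hg⟩ : F)⁻¹ := Subtype.ext (by simp)
  rw [this, toAb_mul, toAb_mul, toAb_inv]
  simp

lemma engel_rep {G : Type*} [Group G] (F : Subgroup G) [hF : F.Normal] (g : G) (f : F) (n : ℕ) :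
    ∃ e : F, (e : G) = engel (f : G) g n ∧ toAb e = ((conjRep F g⁻¹ - 1) ^ n) (toAb f) := by
  induction n with
  | zero => exact ⟨f, rfl, by simp⟩
  | succ n ih =>
    obtain ⟨e, he1, he2⟩ := ih
    refine ⟨e⁻¹ * MulAut.conjNormal g⁻¹ e, ?_, ?_⟩
    · show _ = gComm (engel (f : G) g n) g
      rw [← he1]
      simp [gComm, mul_assoc]
    · rw [toAb_mul, toAb_inv, ← conjRep_toAb, pow_succ', Module.End.mul_apply, ← he2]
      simp [sub_eq_neg_add]

lemma card_le_sink {G : Type*} [Group G] [Finite G] {F : Subgroup G} (S : Set G)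
    (W : Submodule ℤ (Additive (Abelianization F)))
    (h : ∀ w ∈ W, ∃ e : F, (e : G) ∈ S ∧ toAb e = w) : Nat.card W ≤ S.ncard := by
  choose e he1 he2 using h
  let f : W → S := fun w => ⟨e w w.2, he1 w w.2⟩
  have hf : Function.Injective f := by
    intro a b hab
    have h1 : (e a a.2 : G) = e b b.2 := congrArg (fun s : S => (s : G)) hab
    have h2 : e a a.2 = e b b.2 := Subtype.ext h1
    apply Subtype.ext
    rw [← he2 a a.2, ← he2 b b.2, h2]
  exact Nat.card_le_card_of_injective f hf

lemma leftSink_spec {G : Type*} [Group G] [Finite G] (g : G) :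
    ∃ N : ℕ, ∀ l, N ≤ l → ∀ x, engel x g l ∈ leftEngelSink g := by
  have h : ∀ᶠ l in Filter.atTop, ∀ E ∈ {E : Set G | IsLeftEngelSink g E}, ∀ x, engel x g l ∈ E := by
    rw [Filter.eventually_all_finite (Set.toFinite _)]
    intro E hE
    rw [Filter.eventually_all]
    intro x
    obtain ⟨N, -, hN⟩ := hE x
    exact Filter.eventually_atTop.mpr ⟨N, hN⟩
  obtain ⟨N, hN⟩ := Filter.eventually_atTop.mp h
  exact ⟨N, fun l hl x => Set.mem_sInter.mpr fun E hE => hN l hl E hE x⟩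

lemma rightSink_spec {G : Type*} [Group G] [Finite G] (g : G) :
    ∃ N : ℕ, ∀ l, N ≤ l → ∀ x, engel g x l ∈ rightEngelSink g := by
  have h : ∀ᶠ l in Filter.atTop, ∀ E ∈ {E : Set G | IsRightEngelSink g E}, ∀ x, engel g x l ∈ E := by
    rw [Filter.eventually_all_finite (Set.toFinite _)]
    intro E hE
    rw [Filter.eventually_all]
    intro x
    obtain ⟨N, -, hN⟩ := hE x
    exact Filter.eventually_atTop.mpr ⟨N, hN⟩
  obtain ⟨N, hN⟩ := Filter.eventually_atTop.mp h
  exact ⟨N, fun l hl x => Set.mem_sInter.mpr fun E hE => hN l hl E hE x⟩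

instance finite_abq {G : Type*} [Group G] [Finite G] (F : Subgroup G) :
    Finite (Additive (Abelianization F)) := by
  have : Finite (Abelianization F) := Quotient.finite _
  exact this

lemma left_bound {G : Type*} [Group G] [Finite G] (F : Subgroup G) [F.Normal] (g : G) :
    Nat.card (evRange (conjRep F g⁻¹ - 1)) ≤ (leftEngelSink g).ncard := by
  apply card_le_sink
  intro w hw
  obtain ⟨N, hN⟩ := leftSink_spec g
  rw [evRange, Submodule.mem_iInf] at hw
  obtain ⟨v, rfl⟩ := hw N
  obtain ⟨f, rfl⟩ := toAb_surj v
  obtain ⟨e, he1, he2⟩ := engel_rep F g f N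
  exact ⟨e, he1 ▸ hN N le_rfl f, he2⟩

lemma engel_conj {G : Type*} [Group G] (x g h : G) (n : ℕ) :
    engel (h * x * h⁻¹) (h * g * h⁻¹) n = h * engel x g n * h⁻¹ := by
  induction n with
  | zero => rfl
  | succ n ih =>
    show gComm _ _ = h * gComm _ _ * h⁻¹
    rw [ih]
    simp [gComm, mul_assoc]

lemma engel_swap {G : Type*} [Group G] (x g : G) (n : ℕ) :
    engel g⁻¹ (x * g * x⁻¹) (n + 1) = (x * g) * engel x g (n + 2) * (x * g)⁻¹ := by
  induction n with
  | zero => simp [engel, gComm, mul_assoc]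
  | succ n ih =>
    show gComm (engel g⁻¹ (x * g * x⁻¹) (n + 1)) _ = (x * g) * gComm (engel x g (n+2)) g * (x * g)⁻¹
    rw [ih]
    simp [gComm, mul_assoc]

lemma right_bound {G : Type*} [Group G] [Finite G] (F : Subgroup G) [F.Normal] (g : G) :
    Nat.card (evRange (conjRep F g⁻¹ - 1)) ≤ (rightEngelSink g⁻¹).ncard := by
  apply card_le_sink
  intro w hw
  obtain ⟨N, hN⟩ := rightSink_spec g⁻¹
  have hcm : Commute (conjRep F g⁻¹) (conjRep F g⁻¹ - 1) :=
    (Commute.refl _).sub_right (Commute.one_right _)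
  have hw2 := evRange_map_le _ _ hcm hw
  rw [evRange, Submodule.mem_iInf] at hw2
  obtain ⟨v, hv⟩ := hw2 (N + 2)
  obtain ⟨f, rfl⟩ := toAb_surj v
  obtain ⟨e, he1, he2⟩ := engel_rep F g f (N + 2)
  refine ⟨MulAut.conjNormal (f * g : G) e, ?_, ?_⟩
  · have := hN (N + 1) (by omega) (f * g * (f : G)⁻¹)
    rw [engel_swap, ← he1] at this
    exact this
  · rw [← conjRep_toAb, he2, hv, map_mul, conjRep_eq_one F f f.2, one_mul,
      ← Module.End.mul_apply, ← map_mul]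
    simp

/-! ### Fitting series -/

lemma fitting_comap_equiv {G H : Type*} [Group G] [Group H] [Finite G] [Finite H] (e : G ≃* H) :
    (fittingSubgroup H).comap e.toMonoidHom = fittingSubgroup G := by
  apply le_antisymm
  · apply le_fitting _ (Subgroup.Normal.comap inferInstance _)
    exact Group.nilpotent_of_mulEquiv (e.symm.subgroupMap (fittingSubgroup H) |>.trans
      (MulEquiv.subgroupCongr (by
        exact (Subgroup.comap_equiv_eq_map_symm e _).symm)))
  · rw [← Subgroup.map_le_iff_le_comap]
    exact le_fitting _ (Subgroup.Normal.map inferInstance _ e.surjective)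
      (Group.nilpotent_of_mulEquiv (e.subgroupMap (fittingSubgroup G)))

lemma fittingSeries_one {G : Type*} [Group G] [Finite G] :
    fittingSeries G 1 = fittingSubgroup G :=
  fitting_comap_equiv (QuotientGroup.quotientBot (G := G)).symm

lemma quotient_nilpotent {G : Type*} [Group G] [Finite G] (h : fittingSeries G 2 = ⊤) :
    Group.IsNilpotent (G ⧸ fittingSubgroup G) := by
  have h1 : (fittingSubgroup (G ⧸ fittingSeries G 1)).comap
      (QuotientGroup.mk' (fittingSeries G 1)) = ⊤ := h
  have h2 : fittingSubgroup (G ⧸ fittingSeries G 1) = ⊤ := by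
    apply Subgroup.comap_injective (QuotientGroup.mk'_surjective (fittingSeries G 1))
    rw [h1, Subgroup.comap_top]
  have h3 := fitting_nilpotent (G ⧸ fittingSeries G 1)
  rw [h2] at h3
  have h4 : Group.IsNilpotent (G ⧸ fittingSeries G 1) :=
    Group.nilpotent_of_mulEquiv Subgroup.topEquiv
  exact Group.nilpotent_of_mulEquiv (QuotientGroup.quotientMulEquivOfEq fittingSeries_one)

lemma unipotent_mem {G : Type*} [Group G] [Finite G]
    (hq : Group.IsNilpotent (G ⧸ fittingSubgroup G)) (g : G)
    (hg : IsNilpotent (conjRep (fittingSubgroup G) g⁻¹ - 1)) : g ∈ fittingSubgroup G := by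
  set F := fittingSubgroup G with hFdef
  set K := F ⊔ Subgroup.zpowers g with hK
  have hFK : F ≤ K := le_sup_left
  have hgK : g ∈ K := Subgroup.mem_sup_right (Subgroup.mem_zpowers g)
  refine nilpotent_le_fitting hq K hFK ?_ hgK
  have hFn : Group.IsNilpotent F := fitting_nilpotent G
  have : Group.IsNilpotent (F.subgroupOf K) :=
    Group.nilpotent_of_mulEquiv (Subgroup.subgroupOfEquivOfLe hFK).symm
  apply hall_crit (F.subgroupOf K) ⟨g, hgK⟩
  · apply Subgroup.map_injective K.subtype_injective
    rw [Subgroup.map_sup, Subgroup.map_subgroupOf_eq_of_le hFK, MonoidHom.map_zpowers,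
      ← MonoidHom.range_eq_map, K.range_subtype]
    rfl
  · intro f hf
    obtain ⟨n, hn⟩ := hg
    refine ⟨n, ?_⟩
    obtain ⟨e, he1, he2⟩ := engel_rep F g ⟨f, hf⟩ n
    rw [hn] at he2
    have h1 := toAb_eq_zero e he2
    have hcoe : ∀ n, ((engel f ⟨g, hgK⟩ n : K) : G) = engel (f : G) g n := by
      intro n
      induction n with
      | zero => rfl
      | succ n ih => show ((gComm _ _ : K) : G) = gComm _ _; rw [← ih]; rfl
    have h2 : (⁅F.subgroupOf K, F.subgroupOf K⁆).map K.subtype = ⁅F, F⁆ := by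
      rw [Subgroup.map_commutator, Subgroup.map_subgroupOf_eq_of_le hFK]
    rw [he1, ← h2] at h1
    obtain ⟨z, hz, hze⟩ := h1
    have : z = engel f ⟨g, hgK⟩ n := Subtype.ext (by rw [hcoe]; exact hze)
    rwa [← this]

lemma main_bound {G : Type*} [Group G] [Finite G] (A : Subgroup (MulAut G)) (m : ℕ)
    (hA : (Nat.card A).Coprime (Nat.card G))
    (hs : (∀ g ∈ fixedSubgroup A, (leftEngelSink g).ncard ≤ m) ∨
         (∀ g ∈ fixedSubgroup A, (rightEngelSink g).ncard ≤ m))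
    (h2 : fittingSeries G 2 = ⊤) :
    Nat.card {x : G ⧸ fittingSubgroup G //
            ∀ a ∈ A, QuotientGroup.map (fittingSubgroup G) (fittingSubgroup G)
              (a : MulAut G).toMonoidHom (fittingSubgroup_le_comap a) x = x}
          ≤ m.factorial * m.factorial.factorial := by
  have hq := quotient_nilpotent h2
  set F := fittingSubgroup G with hFdef
  have hFn : Group.IsNilpotent F := fitting_nilpotent G
  let D : Subgroup (G ⧸ F) :=
    { carrier := {x | ∀ a ∈ A, QuotientGroup.map F F
              (a : MulAut G).toMonoidHom (fittingSubgroup_le_comap a) x = x}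
      one_mem' := fun a _ => map_one _
      mul_mem' := fun {x y} hx hy a ha => by rw [map_mul, hx a ha, hy a ha]
      inv_mem' := fun {x} hx a ha => by rw [map_inv, hx a ha] }
  show Nat.card D ≤ _
  have hlift : ∀ x ∈ D, ∃ g ∈ fixedSubgroup A, (QuotientGroup.mk g : G ⧸ F) = x := by
    intro x hx
    obtain ⟨g, rfl⟩ := QuotientGroup.mk_surjective x
    obtain ⟨n, hn, hfix⟩ := coprime_lift A hA F inferInstance
      (fun a _ n hn => fittingSubgroup_le_comap a hn) g (by
        intro a ha
        have := hx a ha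
        exact QuotientGroup.eq.mp this.symm)
    exact ⟨g * n, hfix, by rw [QuotientGroup.mk_mul_of_mem _ hn]⟩
  let ρ : G ⧸ F →* Module.End ℤ (Additive (Abelianization F)) :=
    QuotientGroup.lift F (conjRep F) (fun g hg => conjRep_eq_one F g hg)
  have hρ : ∀ g : G, ρ (QuotientGroup.mk g) = conjRep F g := fun g => rfl
  have hsmall : ∀ x ∈ D, Nat.card (evRange (ρ x - 1)) ≤ m := by
    intro x hx
    obtain ⟨g, hg, rfl⟩ := hlift x hx
    rw [hρ]
    rcases hs with hs | hs
    · have h := left_bound F g⁻¹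
      rw [inv_inv] at h
      exact h.trans (hs _ (Subgroup.inv_mem _ hg))
    · have h := right_bound F g⁻¹
      rw [inv_inv] at h
      exact h.trans (hs _ hg)
  have huni : ∀ x : G ⧸ F, IsNilpotent (ρ x - 1) → x = 1 := by
    intro x hx
    obtain ⟨g, rfl⟩ := QuotientGroup.mk_surjective x
    rw [hρ] at hx
    rw [QuotientGroup.eq_one_iff, ← Subgroup.inv_mem_iff]
    apply unipotent_mem hq
    rwa [inv_inv]
  apply nilpotent_bound
  intro B hB
  apply abelian_bound (B := B) (fun x y => Subtype.ext (hB x x.2 y y.2))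
    ((ρ.comp D.subtype).comp B.subtype) m
  · intro b
    exact hsmall _ (b : D).2
  · intro b hb
    have := huni _ hb
    exact Subtype.ext (Subtype.ext this)

/-- **Proposition 3.1.** Let `G` be a finite group admitting a group of automorphisms `A` of
order coprime to `|G|`, and `m` a positive integer such that either (a) every `g ∈ C_G(A)` has
a left Engel sink of cardinality at most `m`, or (b) every `g ∈ C_G(A)` has a right Engel sink
of cardinality at most `m`. If `G = F_2(G)`, then `|C_{G/F(G)}(A)|` is bounded in terms
of `m` alone. -/
theorem statement_4 :
    ∃ f : ℕ → ℕ,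
      ∀ (G : Type u) [Group G] [Finite G] (A : Subgroup (MulAut G)) (m : ℕ),
        0 < m → (Nat.card A).Coprime (Nat.card G) →
        ((∀ g ∈ fixedSubgroup A, (leftEngelSink g).ncard ≤ m) ∨
         (∀ g ∈ fixedSubgroup A, (rightEngelSink g).ncard ≤ m)) →
        fittingSeries G 2 = ⊤ →
        Nat.card {x : G ⧸ fittingSubgroup G //
            ∀ a ∈ A, QuotientGroup.map (fittingSubgroup G) (fittingSubgroup G)
              (a : MulAut G).toMonoidHom (fittingSubgroup_le_comap a) x = x}
          ≤ f m := by
  exact ⟨fun m => m.factorial * m.factorial.factorial, fun G _ _ A m _ hA hs h2 => main_bound A m hA hs h2⟩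
end

section
/- Let V be an elementary abelian finite p-group, let U be a group of automorphisms of V with gcd(|U|, p) = 1, and let r be a positive integer. If for every u ∈ U the subgroup [V, u] has rank at most r, then the rank of U is bounded in terms of r alone (there is a function f : ℕ → ℕ, independent of p, V and U, with rank(U) ≤ f(r)). -/
universe u

namespace RankAux
open Module


/-- isometric rep: orthogonality of eigenvectors -/
theorem eig_orth {E : Type*} [NormedAddCommGroup E] [InnerProductSpace ℂ E]
    (A : E →ₗ[ℂ] E) (hA : ∀ v, ‖A v‖ = ‖v‖) {v w : E} {μ ν : ℂ} (hv : A v = μ • v)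
    (hw : A w = ν • w) (hv0 : v ≠ 0) (hne : μ ≠ ν) : inner ℂ v w = 0 := by
  have hin : inner ℂ (A v) (A w) = inner ℂ v w := by
    let L : E →ₗᵢ[ℂ] E := ⟨A, hA⟩
    exact L.inner_map_map v w
  have hμ : ‖μ‖ = 1 := by
    have := hA v
    rw [hv, norm_smul] at this
    have h0 : ‖v‖ ≠ 0 := norm_ne_zero_iff.2 hv0
    field_simp at this
    exact this
  rw [hv, hw, inner_smul_left, inner_smul_right] at hin
  by_contra h
  have h1 : (starRingEnd ℂ) μ * ν = 1 := by
    have : ((starRingEnd ℂ) μ * ν - 1) * inner ℂ v w = 0 := by linear_combination hin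
    rcases mul_eq_zero.1 this with h2 | h2
    · linear_combination h2
    · exact absurd h2 h
  have h2 : μ * (starRingEnd ℂ) μ = 1 := by
    rw [Complex.mul_conj, Complex.normSq_eq_norm_sq, hμ]; simp
  apply hne
  linear_combination ν * h2 - μ * h1

theorem commute_of_comm {G : Type*} [Group G] [Finite G] {E : Type*} [NormedAddCommGroup E]
    [InnerProductSpace ℂ E] [FiniteDimensional ℂ E] (φ : G →* Module.End ℂ E)
    (hiso : ∀ g v, ‖φ g v‖ = ‖v‖) (hinj : Function.Injective φ) (a b : G)
    (hb : ∀ v, ‖φ b v - v‖ ≤ ‖v‖) (hc : Commute a (a * b * a⁻¹ * b⁻¹)) : Commute a b := by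
  set c := a * b * a⁻¹ * b⁻¹ with hcdef
  suffices h : c = 1 by
    have : a * b = b * a := by
      have := congrArg (· * (b * a)) h
      simpa [hcdef, mul_assoc] using this
    exact this
  by_contra hc1
  have hmul : ∀ x y : G, ∀ v, φ (x * y) v = φ x (φ y v) := fun x y v => by
    rw [map_mul]; rfl
  have hinv : ∀ x : G, ∀ v, φ x⁻¹ (φ x v) = v := fun x v => by
    rw [← hmul]; simp
  -- a fixed vector in the range is zero
  have key : ∀ x, φ c (φ c x - x) = φ c x - x → φ c x = x := by
    intro x hx
    have h1 : ∀ m : ℕ, φ (c ^ m) x = x + (m : ℂ) • (φ c x - x) := by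
      intro m
      induction m with
      | zero => simp
      | succ m ih =>
        rw [pow_succ', hmul, ih, map_add, map_smul, hx]
        push_cast
        module
    have h2 := h1 (orderOf c)
    rw [pow_orderOf_eq_one, map_one] at h2
    have h3 : ((orderOf c : ℕ) : ℂ) • (φ c x - x) = 0 := by
      have : x = x + ((orderOf c : ℕ) : ℂ) • (φ c x - x) := h2
      simpa using this
    rcases smul_eq_zero.1 h3 with h4 | h4
    · exact absurd h4 (by exact_mod_cast (orderOf_pos c).ne')
    · exact sub_eq_zero.1 h4
  let W := LinearMap.range (φ c - 1)
  have hW : ∀ w ∈ W, φ c w ∈ W := by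
    rintro _ ⟨x, rfl⟩
    exact ⟨φ c x, by simp⟩
  have hWnt : Nontrivial W := by
    rw [Submodule.nontrivial_iff_ne_bot]
    intro hbot
    apply hc1
    apply hinj
    rw [map_one]
    have := LinearMap.range_eq_bot.1 hbot
    exact sub_eq_zero.1 this
  obtain ⟨lam, hlam⟩ := Module.End.exists_eigenvalue ((φ c).restrict hW)
  obtain ⟨w, hw⟩ := hlam.exists_hasEigenvector
  have hw0 : (w : E) ≠ 0 := fun h => hw.2 (Subtype.ext h)
  have hwe : φ c w = lam • (w : E) := by
    have := congrArg Subtype.val hw.apply_eq_smul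
    simpa using this
  have hlam1 : lam ≠ 1 := by
    rintro rfl
    obtain ⟨x, hx⟩ := w.2
    have hx' : φ c x - x = w := hx
    have := key x (by rw [hx', hwe, one_smul])
    rw [this, sub_self] at hx'
    exact hw0 hx'.symm
  let Eig := Module.End.eigenspace (φ c) lam
  have hEig : ∀ w ∈ Eig, φ a w ∈ Eig := by
    intro w hw
    rw [Module.End.mem_eigenspace_iff] at hw ⊢
    rw [← hmul, ← hc.eq, hmul, hw, map_smul]
  have : Nontrivial Eig := by
    rw [Submodule.nontrivial_iff_ne_bot]
    intro hbot
    have : (w : E) ∈ Eig := Module.End.mem_eigenspace_iff.2 hwe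
    rw [hbot] at this
    exact hw0 (by simpa using this)
  obtain ⟨mu, hmu⟩ := Module.End.exists_eigenvalue ((φ a).restrict hEig)
  obtain ⟨v, hv⟩ := hmu.exists_hasEigenvector
  have hv0 : (v : E) ≠ 0 := fun h => hv.2 (Subtype.ext h)
  have hva : φ a v = mu • (v : E) := by
    have := congrArg Subtype.val hv.apply_eq_smul
    simpa using this
  have hvc : φ c v = lam • (v : E) := Module.End.mem_eigenspace_iff.1 v.2
  have hmu0 : mu ≠ 0 := by
    rintro rfl
    have := hiso a v
    rw [hva] at this
    simp at this
    exact hv0 (norm_eq_zero.1 this.symm)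
  have hlam0 : lam ≠ 0 := by
    rintro rfl
    have := hiso c v
    rw [hvc] at this
    simp at this
    exact hv0 (norm_eq_zero.1 this.symm)
  set w' := φ b⁻¹ (v : E) with hw'
  -- b a⁻¹ b⁻¹ v = (lam / mu) v
  have h1 : φ (b * a⁻¹ * b⁻¹) v = (lam / mu) • (v : E) := by
    have h2 : b * a⁻¹ * b⁻¹ = a⁻¹ * c := by rw [hcdef]; group
    rw [h2, hmul, hvc, map_smul]
    have h3 : φ a⁻¹ (v : E) = mu⁻¹ • (v : E) := by
      have := hinv a v
      rw [hva, map_smul] at this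
      conv_rhs => rw [← this]
      rw [smul_smul, inv_mul_cancel₀ hmu0, one_smul]
    rw [h3, smul_smul, div_eq_mul_inv]
  have h2 : φ a⁻¹ w' = (lam / mu) • w' := by
    have h3 : φ b⁻¹ (φ (b * a⁻¹ * b⁻¹) v) = φ a⁻¹ w' := by
      rw [← hmul, hw', ← hmul]; congr 2; group
    rw [← h3, h1, map_smul]
  have h3 : φ a w' = (mu / lam) • w' := by
    have := congrArg (φ a) h2
    rw [← hmul, mul_inv_cancel, map_one, map_smul] at this
    have h4 : w' = (lam / mu) • φ a w' := this
    conv_rhs => rw [h4]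
    rw [smul_smul]
    field_simp
    simp
  have hne : mu ≠ mu / lam := by
    intro h
    field_simp at h
    exact hlam1 h
  have horth := eig_orth (φ a) (hiso a) hva h3 hv0 hne
  have h4 : φ b w' = v := by rw [hw', ← hmul]; simp
  have h5 := hb w'
  rw [h4] at h5
  have hn : ‖w'‖ = ‖(v : E)‖ := hiso _ _
  have h6 : ‖(v : E) - w'‖ * ‖(v : E) - w'‖ = ‖(v : E)‖ * ‖(v : E)‖ + ‖w'‖ * ‖w'‖ :=
    by
      have h8 := norm_sub_sq (𝕜 := ℂ) (v : E) w'
      rw [horth] at h8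
      simp at h8
      linarith [h8]
  rw [hn] at h5 h6
  have h7 : 0 < ‖(v : E)‖ := norm_pos_iff.2 hv0
  nlinarith [norm_nonneg ((v : E) - w')]

theorem near_commute {G : Type*} [Group G] [Finite G] {E : Type*} [NormedAddCommGroup E]
    [InnerProductSpace ℂ E] [FiniteDimensional ℂ E] (φ : G →* Module.End ℂ E)
    (hiso : ∀ g v, ‖φ g v‖ = ‖v‖) (hinj : Function.Injective φ) (a b : G)
    (ha : ∀ v, ‖φ a v - v‖ ≤ (1/3) * ‖v‖)
    (hb : ∀ v, ‖φ b v - v‖ ≤ (1/3) * ‖v‖) : Commute a b := by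
  have hmul : ∀ x y : G, ∀ v, φ (x * y) v = φ x (φ y v) := fun x y v => by
    rw [map_mul]; rfl
  let c : ℕ → G := fun k => Nat.rec b (fun _ x => a * x * a⁻¹ * x⁻¹) k
  have hc0 : c 0 = b := rfl
  have hcs : ∀ k, c (k+1) = a * c k * a⁻¹ * (c k)⁻¹ := fun k => rfl
  have hbound : ∀ k v, ‖φ (c k) v - v‖ ≤ (2/3)^k * ‖v‖ := by
    intro k
    induction k with
    | zero => intro v; rw [hc0]; have := hb v; have := norm_nonneg v; simp; linarith
    | succ k ih =>
      intro v
      rw [hcs]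
      set x := c k
      set w := φ (a⁻¹ * x⁻¹) v with hw
      have hwn : ‖w‖ = ‖v‖ := hiso _ _
      have h1 : φ (a * x * a⁻¹ * x⁻¹) v = φ a (φ x w) := by
        rw [hw, ← hmul, ← hmul]; congr 2; group
      have h2 : v = φ x (φ a w) := by
        rw [hw, ← hmul, ← hmul]
        have : x * a * (a⁻¹ * x⁻¹) = 1 := by group
        rw [this]; simp
      have h3 : φ a (φ x w) - φ x (φ a w)
          = (φ a (φ x w - w) - (φ x w - w)) - (φ x (φ a w - w) - (φ a w - w)) := by
        simp only [map_sub]; abel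
      rw [h1]
      conv_lhs => rw [h2]
      rw [h3]
      have h4 := ha (φ x w - w)
      have h5 := ih w
      have h6 := ih (φ a w - w)
      have h7 := ha w
      have h8 : (0:ℝ) ≤ (2/3)^k := by positivity
      calc _ ≤ ‖φ a (φ x w - w) - (φ x w - w)‖ + ‖φ x (φ a w - w) - (φ a w - w)‖ := norm_sub_le _ _
        _ ≤ 1/3 * ((2/3)^k * ‖w‖) + (2/3)^k * (1/3 * ‖w‖) := by
          refine add_le_add (h4.trans ?_) (h6.trans ?_) <;> gcongr
        _ = (2/3)^(k+1) * ‖v‖ := by rw [hwn]; ring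
  -- eventually trivial
  have hev : ∃ k, c k = 1 := by
    apply Classical.byContradiction
    intro hne
    push Not at hne
    -- for each g, eventually not equal c k
    have h1 : ∀ g : G, g ≠ 1 → ∃ K, ∀ k ≥ K, c k ≠ g := by
      intro g hg
      have : ∃ v, φ g v ≠ v := by
        by_contra hh
        push Not at hh
        exact hg (hinj (by rw [map_one]; exact LinearMap.ext hh))
      obtain ⟨v, hv⟩ := this
      have hpos : 0 < ‖φ g v - v‖ := norm_pos_iff.2 (sub_ne_zero.2 hv)
      have hlim : Filter.Tendsto (fun k : ℕ => (2/3 : ℝ)^k * ‖v‖) Filter.atTop (nhds 0) := by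
        have := (tendsto_pow_atTop_nhds_zero_of_lt_one (r := (2/3:ℝ)) (by norm_num)
          (by norm_num)).mul_const ‖v‖
        simpa using this
      have := hlim.eventually (gt_mem_nhds hpos)
      obtain ⟨K, hK⟩ := Filter.eventually_atTop.1 this
      refine ⟨K, fun k hk hkg => ?_⟩
      have h2 := hbound k v
      rw [hkg] at h2
      exact absurd (hK k hk) (not_lt.2 h2)
    choose! K hK using h1
    have := Fintype.ofFinite G
    let k := Finset.univ.sup K
    exact hK (c k) (hne k) k (Finset.le_sup (Finset.mem_univ _)) rfl
  obtain ⟨k, hk⟩ := hev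
  have hdown : ∀ j, Commute a (c j) → Commute a (c 0) := by
    intro j
    induction j with
    | zero => exact id
    | succ j ih =>
      intro h
      apply ih
      apply commute_of_comm φ hiso hinj a (c j) _ h
      intro v
      refine (hbound j v).trans ?_
      have : (2/3:ℝ)^j ≤ 1 := pow_le_one₀ (by norm_num) (by norm_num)
      nlinarith [norm_nonneg v]
  exact hdown k (by rw [hk]; exact Commute.one_right a)



theorem abelian_gen {G : Type*} [Group G] [Finite G] {E : Type*} [NormedAddCommGroup E]
    [InnerProductSpace ℂ E] [FiniteDimensional ℂ E] (φ : G →* Module.End ℂ E)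
    (hiso : ∀ g v, ‖φ g v‖ = ‖v‖) (d : ℕ) : ∀ (W : Submodule ℂ E) (H : Subgroup G),
    finrank ℂ W = d → (∀ x ∈ H, ∀ y ∈ H, Commute x y) → (∀ h ∈ H, ∀ w ∈ W, φ h w ∈ W) →
    ∃ S : Finset G, S.card ≤ d ∧ (∀ s ∈ S, s ∈ H) ∧
      ∀ h ∈ H, ∃ s ∈ Subgroup.closure (S : Set G), ∀ w ∈ W, φ h w = φ s w := by
  classical
  have hmul : ∀ x y : G, ∀ v, φ (x * y) v = φ x (φ y v) := fun x y v => by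
    rw [map_mul]; rfl
  have hinv : ∀ x : G, ∀ v, φ x⁻¹ (φ x v) = v := fun x v => by
    rw [← hmul]; simp
  have hinv' : ∀ x : G, ∀ v, φ x (φ x⁻¹ v) = v := fun x v => by
    rw [← hmul]; simp
  have hinner : ∀ g v w, inner ℂ (φ g v) (φ g w) = inner ℂ v w := by
    intro g v w
    let L : E →ₗᵢ[ℂ] E := ⟨φ g, hiso g⟩
    exact L.inner_map_map v w
  induction d using Nat.strong_induction_on with
  | _ d ih =>
  intro W H hd hcomm hinvt
  by_cases hW0 : W = ⊥
  · refine ⟨∅, by simp, by simp, fun h _ => ⟨1, one_mem _, ?_⟩⟩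
    intro w hw
    rw [hW0] at hw
    rw [(Submodule.mem_bot ℂ).1 hw]; simp
  have hWnt : Nontrivial W := (Submodule.nontrivial_iff_ne_bot).2 hW0
  have hdpos : 0 < d := by rw [← hd]; exact Module.finrank_pos
  by_cases hsc : ∀ h ∈ H, ∃ c : ℂ, ∀ w ∈ W, φ h w = c • w
  · choose! c hc using hsc
    obtain ⟨w0, hw0⟩ := exists_ne (0 : W)
    have hw0' : (w0 : E) ≠ 0 := fun h => hw0 (Subtype.ext h)
    let χ : H →* ℂ :=
      { toFun := fun h => c h
        map_one' := by
          have := hc 1 (one_mem _) w0 w0.2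
          rw [map_one] at this
          have h2 : (c 1 - 1) • (w0 : E) = 0 := by
            rw [sub_smul, ← this]; simp
          rcases smul_eq_zero.1 h2 with h3 | h3
          · exact sub_eq_zero.1 h3
          · exact absurd h3 hw0'
        map_mul' := by
          intro x y
          have h1 := hc (x * y) (mul_mem x.2 y.2) w0 w0.2
          rw [hmul, hc y y.2 w0 w0.2, map_smul, hc x x.2 w0 w0.2, smul_smul] at h1
          have h2 : (c (x * y) - c x * c y) • (w0 : E) = 0 := by
            rw [sub_smul, ← h1, mul_comm]; simp
          rcases smul_eq_zero.1 h2 with h3 | h3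
          · exact sub_eq_zero.1 h3
          · exact absurd h3 hw0' }
    have hfin : Finite χ.toHomUnits.range :=
      Finite.of_surjective _ χ.toHomUnits.rangeRestrict_surjective
    obtain ⟨⟨_, ⟨h0, rfl⟩⟩, hgen⟩ := IsCyclic.exists_generator (α := χ.toHomUnits.range)
    refine ⟨{(h0 : G)}, by simp; omega, by simp, ?_⟩
    intro h hh
    have := hgen ⟨_, ⟨⟨h, hh⟩, rfl⟩⟩
    obtain ⟨k, hk⟩ := Subgroup.mem_zpowers_iff.1 this
    have hk' := congrArg Subtype.val hk
    simp only [Subgroup.coe_zpow] at hk'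
    rw [← map_zpow] at hk'
    have hk2 := congrArg Units.val hk'
    have hk3 : c ((h0 : G) ^ k) = c h := by
      rw [MonoidHom.coe_toHomUnits, MonoidHom.coe_toHomUnits] at hk2
      exact hk2
    refine ⟨(h0 : G) ^ k, ?_, ?_⟩
    · apply Subgroup.zpow_mem
      apply Subgroup.subset_closure; simp
    · intro w hw
      rw [hc h hh w hw, hc _ (H.zpow_mem h0.2 k) w hw, hk3]
  · push Not at hsc
    obtain ⟨h0, hh0, hns⟩ := hsc
    obtain ⟨μ, hμ⟩ := Module.End.exists_eigenvalue ((φ h0).restrict (hinvt h0 hh0))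
    obtain ⟨v, hv⟩ := hμ.exists_hasEigenvector
    have hv0 : (v : E) ≠ 0 := fun h => hv.2 (Subtype.ext h)
    have hve : φ h0 v = μ • (v : E) := by
      have := congrArg Subtype.val hv.apply_eq_smul
      simpa using this
    let W1 := W ⊓ Module.End.eigenspace (φ h0) μ
    let W2 := W1ᗮ ⊓ W
    have hW1le : W1 ≤ W := inf_le_left
    have hW1pos : 0 < finrank ℂ W1 := by
      rw [Module.finrank_pos_iff, Submodule.nontrivial_iff_ne_bot]
      intro hbot
      have : (v : E) ∈ W1 := ⟨v.2, Module.End.mem_eigenspace_iff.2 hve⟩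
      rw [hbot] at this
      exact hv0 ((Submodule.mem_bot ℂ).1 this)
    have hW1lt : finrank ℂ W1 < d := by
      rw [← hd]
      apply Submodule.finrank_lt_finrank_of_lt
      refine lt_of_le_of_ne hW1le ?_
      intro heq
      obtain ⟨w, hw, hwn⟩ := hns μ
      rw [← heq] at hw
      exact hwn (Module.End.mem_eigenspace_iff.1 hw.2)
    have hsum : finrank ℂ W1 + finrank ℂ W2 = d := by
      rw [← hd]; exact Submodule.finrank_add_inf_finrank_orthogonal hW1le
    have hinv1 : ∀ h ∈ H, ∀ w ∈ W1, φ h w ∈ W1 := by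
      intro h hh w hw
      refine ⟨hinvt h hh w hw.1, ?_⟩
      apply Module.End.mem_eigenspace_iff.2
      rw [← hmul, (hcomm h0 hh0 h hh).eq, hmul,
        Module.End.mem_eigenspace_iff.1 hw.2, map_smul]
    have hinv2 : ∀ h ∈ H, ∀ w ∈ W2, φ h w ∈ W2 := by
      intro h hh w hw
      refine ⟨?_, hinvt h hh w hw.2⟩
      apply (Submodule.mem_orthogonal _ _).2
      intro u hu
      rw [← hinv' h u, hinner]
      exact (Submodule.mem_orthogonal _ _).1 hw.1 _ (hinv1 _ (inv_mem hh) u hu)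
    obtain ⟨S1, hS1c, hS1H, hS1⟩ := ih _ hW1lt W1 H rfl hcomm hinv1
    let H' : Subgroup G :=
      { carrier := {h | h ∈ H ∧ ∀ w ∈ W1, φ h w = w}
        one_mem' := ⟨one_mem _, fun w _ => by simp⟩
        mul_mem' := fun {x y} hx hy => ⟨mul_mem hx.1 hy.1, fun w hw => by
          rw [hmul, hy.2 w hw, hx.2 w hw]⟩
        inv_mem' := fun {x} hx => ⟨inv_mem hx.1, fun w hw => by
          conv_lhs => rw [← hx.2 w hw]
          exact hinv x w⟩ }
    obtain ⟨S2, hS2c, hS2H, hS2⟩ := ih (finrank ℂ W2) (by omega) W2 H' rfl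
      (fun x hx y hy => hcomm x hx.1 y hy.1) (fun h hh => hinv2 h hh.1)
    refine ⟨S1 ∪ S2, (Finset.card_union_le _ _).trans (by omega), ?_, ?_⟩
    · intro s hs
      rcases Finset.mem_union.1 hs with hs | hs
      · exact hS1H s hs
      · exact (hS2H s hs).1
    · intro h hh
      obtain ⟨s1, hs1, he1⟩ := hS1 h hh
      have hs1H : s1 ∈ H := (Subgroup.closure_le H).2 hS1H hs1
      have hmem : s1⁻¹ * h ∈ H' := ⟨mul_mem (inv_mem hs1H) hh, fun w hw => by
        rw [hmul, he1 w hw, hinv]⟩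
      obtain ⟨s2, hs2, he2⟩ := hS2 _ hmem
      have hs2H : s2 ∈ H' := (Subgroup.closure_le H').2 hS2H hs2
      refine ⟨s1 * s2, mul_mem ?_ ?_, ?_⟩
      · exact Subgroup.closure_mono (by simp) hs1
      · exact Subgroup.closure_mono (by simp) hs2
      · intro w hw
        have hsup : W1 ⊔ W1ᗮ ⊓ W = W := Submodule.sup_orthogonal_inf_of_hasOrthogonalProjection hW1le
        rw [← hsup] at hw
        obtain ⟨w1, hw1, w2, hw2, rfl⟩ := Submodule.mem_sup.1 hw
        rw [map_add, map_add, hmul, hmul, hs2H.2 w1 hw1, ← he1 w1 hw1, ← he2 w2 hw2, hmul, hinv']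

/-- Packing constant and generation. -/
theorem jordan_gen (n : ℕ) : ∃ C : ℕ, ∀ (G : Type*) [Group G] [Finite G]
    (φ : G →* Module.End ℂ (EuclideanSpace ℂ (Fin n))), (∀ g v, ‖φ g v‖ = ‖v‖) →
    Function.Injective φ →
    (∀ a b : G, (∀ v, ‖φ a v - v‖ ≤ (1/3) * ‖v‖) → (∀ v, ‖φ b v - v‖ ≤ (1/3) * ‖v‖) →
      Commute a b) →
    ∃ S : Finset G, S.card ≤ C ∧ Subgroup.closure (S : Set G) = ⊤ := by
  classical
  let E := EuclideanSpace ℂ (Fin n)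
  obtain ⟨t, -, htf, htc⟩ := (isCompact_closedBall (0 : E →L[ℂ] E) 1).finite_cover_balls
    (e := 1/6) (by norm_num)
  refine ⟨htf.toFinset.card + n, ?_⟩
  intro G _ _ φ hiso hinj hnear
  have hmul : ∀ x y : G, ∀ v, φ (x * y) v = φ x (φ y v) := fun x y v => by
    rw [map_mul]; rfl
  let near : Set G := {g | ∀ v, ‖φ g v - v‖ ≤ (1/3) * ‖v‖}
  let H := Subgroup.closure near
  have hHc : ∀ x ∈ H, ∀ y ∈ H, Commute x y := by
    have h1 : ∀ x ∈ near, ∀ y ∈ near, x * y = y * x := fun x hx y hy => hnear x y hx hy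
    have := Subgroup.isMulCommutative_closure (k := near) h1
    intro x hx y hy
    have := this.is_comm.comm (⟨x, hx⟩ : H) ⟨y, hy⟩
    exact congrArg Subtype.val this
  obtain ⟨S1, hS1c, hS1H, hS1⟩ := abelian_gen φ hiso n ⊤ H (by simp) hHc (by simp)
  have hHle : H ≤ Subgroup.closure (S1 : Set G) := by
    intro h hh
    obtain ⟨s, hs, he⟩ := hS1 h hh
    have : h = s := hinj (LinearMap.ext fun v => he v trivial)
    rwa [this]
  let L : G → (E →L[ℂ] E) := fun g => LinearMap.toContinuousLinearMap (φ g)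
  have hL : ∀ g, ∃ x ∈ t, L g ∈ Metric.ball x (1/6) := by
    intro g
    have : L g ∈ Metric.closedBall (0 : E →L[ℂ] E) 1 := by
      rw [mem_closedBall_zero_iff]
      refine ContinuousLinearMap.opNorm_le_bound _ zero_le_one fun v => ?_
      simp [L, hiso]
    simpa using htc this
  choose x hx hxb using hL
  let rep : (E →L[ℂ] E) → G := fun y => if h : ∃ g, x g = y then h.choose else 1
  have hrep : ∀ g, x (rep (x g)) = x g := by
    intro g
    have h : ∃ g', x g' = x g := ⟨g, rfl⟩
    have h2 : rep (x g) = h.choose := by simp only [rep]; rw [dif_pos h]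
    rw [h2]; exact h.choose_spec
  refine ⟨htf.toFinset.image rep ∪ S1, ?_, ?_⟩
  · refine (Finset.card_union_le _ _).trans ?_
    exact add_le_add Finset.card_image_le hS1c
  · rw [eq_top_iff]
    intro g _
    set g' := rep (x g) with hg'
    have h1 : g'⁻¹ * g ∈ near := by
      intro v
      have e1 : φ (g'⁻¹ * g) v - v = φ g'⁻¹ (φ g v - φ g' v) := by
        rw [map_sub, ← hmul, ← hmul]; simp
      rw [e1, hiso]
      have e2 : ‖L g - L g'‖ ≤ 1/3 := by
        have a1 := hxb g
        have a2 := hxb g'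
        rw [hrep g] at a2
        rw [Metric.mem_ball, dist_eq_norm] at a1 a2
        have : L g - L g' = (L g - x g) - (L g' - x g) := by abel
        rw [this]
        refine (norm_sub_le _ _).trans ?_
        linarith
      have e3 := (L g - L g').le_of_opNorm_le e2 v
      simpa [L] using e3
    have h2 : g'⁻¹ * g ∈ Subgroup.closure ((htf.toFinset.image rep ∪ S1 : Finset G) : Set G) :=
      Subgroup.closure_mono (by simp) (hHle (Subgroup.subset_closure h1))
    have h3 : g' ∈ Subgroup.closure ((htf.toFinset.image rep ∪ S1 : Finset G) : Set G) := by
      apply Subgroup.subset_closure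
      simp only [Finset.coe_union, Finset.coe_image, Set.Finite.coe_toFinset]
      exact Or.inl ⟨x g, hx g, rfl⟩
    simpa using mul_mem h3 h2


theorem trace_bound {E : Type*} [NormedAddCommGroup E]
    [InnerProductSpace ℂ E] [FiniteDimensional ℂ E] (A : Module.End ℂ E)
    (hiso : ∀ v, ‖A v‖ = ‖v‖) :
    2 * (finrank ℂ (LinearMap.ker (A - 1)) : ℝ) - finrank ℂ E ≤ (LinearMap.trace ℂ E A).re := by
  classical
  set K := LinearMap.ker (A - 1) with hK
  have hAK : ∀ x ∈ K, A x = x := fun x hx => by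
    have : (A - 1) x = 0 := hx
    exact sub_eq_zero.1 this
  let b0 := stdOrthonormalBasis ℂ K
  let w : Fin (finrank ℂ K) → E := fun i => (b0 i : E)
  have hw : Orthonormal ℂ w := b0.orthonormal.comp_linearIsometry K.subtypeₗᵢ
  obtain ⟨u, b, hvu, hb⟩ := hw.toSubtypeRange.exists_orthonormalBasis_extension
  have hn : finrank ℂ E = u.card := by
    rw [Module.finrank_eq_card_basis b.toBasis]; simp
  have hk : finrank ℂ K = (u.filter (· ∈ Set.range w)).card := by
    have h1 : u.filter (· ∈ Set.range w) = Finset.univ.image w := by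
      ext x
      simp only [Finset.mem_filter, Finset.mem_image, Finset.mem_univ, true_and, Set.mem_range]
      exact ⟨fun h => h.2, fun h => ⟨hvu h, h⟩⟩
    rw [h1, Finset.card_image_of_injective _ hw.linearIndependent.injective]
    simp
  rw [LinearMap.trace_eq_sum_inner A b, Complex.re_sum]
  have h2 : ∀ i : u, (if (i : E) ∈ Set.range w then (2:ℝ) else 0) - 1 ≤
      (inner ℂ (b i) (A (b i))).re := by
    intro i
    have hnorm : ‖b i‖ = 1 := b.orthonormal.1 i
    have hbi : b i = (i : E) := by rw [hb]
    split_ifs with h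
    · have : A (b i) = b i := by
        apply hAK
        rw [hbi]
        obtain ⟨j, hj⟩ := h
        rw [← hj]; exact (b0 j).2
      rw [this, inner_self_eq_norm_sq_to_K, hnorm]; norm_num
    · have h3 := norm_inner_le_norm (𝕜 := ℂ) (b i) (A (b i))
      rw [hiso, hnorm] at h3
      have h4 := Complex.abs_re_le_norm (inner ℂ (b i) (A (b i)))
      have := abs_le.1 (h4.trans h3)
      linarith [this.1]
  refine le_trans (le_of_eq ?_) (Finset.sum_le_sum fun i _ => h2 i)
  rw [Finset.sum_coe_sort u (fun i => (if (i : E) ∈ Set.range w then (2:ℝ) else 0) - 1),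
    Finset.sum_sub_distrib, ← Finset.sum_filter, Finset.sum_const, Finset.sum_const, ← hk, ← hn]
  simp; ring

theorem unitary_gen : ∃ F : ℕ → ℕ, ∀ (G : Type*) [Group G] [Finite G] (E : Type*)
    [NormedAddCommGroup E] [InnerProductSpace ℂ E] [FiniteDimensional ℂ E]
    (φ : G →* Module.End ℂ E), (∀ g v, ‖φ g v‖ = ‖v‖) → Function.Injective φ → ∀ r : ℕ,
    (∀ g, finrank ℂ E ≤ finrank ℂ (LinearMap.ker (φ g - 1)) + r) →
    ∃ S : Finset G, S.card ≤ F r ∧ Subgroup.closure (S : Set G) = ⊤ := by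
  choose C hC using jordan_gen
  refine ⟨fun r => ∑ d ∈ Finset.range (2 * r + 1), C d, ?_⟩
  intro G _ _ E _ _ _ φ hiso hinj r hr
  have := Fintype.ofFinite G
  have hmul : ∀ x y : G, ∀ v, φ (x * y) v = φ x (φ y v) := fun x y v => by
    rw [map_mul]; rfl
  have hinv' : ∀ x : G, ∀ v, φ x (φ x⁻¹ v) = v := fun x v => by
    rw [← hmul]; simp
  have hinner : ∀ g v w, inner ℂ (φ g v) (φ g w) = inner ℂ v w := by
    intro g v w
    let L : E →ₗᵢ[ℂ] E := ⟨φ g, hiso g⟩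
    exact L.inner_map_map v w
  let Fx : Submodule ℂ E := ⨅ g, LinearMap.ker (φ g - 1)
  have hFx : ∀ v, v ∈ Fx ↔ ∀ g, φ g v = v := by
    intro v
    simp [Fx, Submodule.mem_iInf, sub_eq_zero]
  have hcard : (Fintype.card G : ℂ) ≠ 0 := by exact_mod_cast Fintype.card_ne_zero
  let P : Module.End ℂ E := (Fintype.card G : ℂ)⁻¹ • ∑ g, φ g
  have hP : LinearMap.IsProj Fx P := by
    constructor
    · intro v
      rw [hFx]
      intro h
      simp only [P, LinearMap.smul_apply, LinearMap.sum_apply, map_smul, map_sum, ← hmul]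
      congr 1
      exact Fintype.sum_equiv (Equiv.mulLeft h) _ _ (fun g => rfl)
    · intro v hv
      simp only [P, LinearMap.smul_apply, LinearMap.sum_apply]
      rw [Finset.sum_congr rfl (fun g _ => (hFx v).1 hv g), Finset.sum_const, Finset.card_univ,
        ← Nat.cast_smul_eq_nsmul ℂ, smul_smul, inv_mul_cancel₀ hcard, one_smul]
  have htr := hP.trace
  have hdim : finrank ℂ E ≤ finrank ℂ Fx + 2 * r := by
    have h1 : ∑ g, LinearMap.trace ℂ E (φ g) = (Fintype.card G : ℂ) * finrank ℂ Fx := by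
      rw [← htr]
      simp only [P, map_smul, map_sum, smul_eq_mul]
      field_simp
    have h2 := congrArg Complex.re h1
    rw [Complex.re_sum] at h2
    have h3 : (Fintype.card G : ℝ) * (finrank ℂ E - 2 * r) ≤ ∑ g, (LinearMap.trace ℂ E (φ g)).re := by
      rw [← nsmul_eq_mul, ← Finset.card_univ, ← Finset.sum_const]
      apply Finset.sum_le_sum
      intro g _
      have h4 := trace_bound (φ g) (hiso g)
      have h5 : (finrank ℂ E : ℝ) ≤ finrank ℂ (LinearMap.ker (φ g - 1)) + r := by
        exact_mod_cast hr g
      linarith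
    rw [h2] at h3
    have h6 : ((Fintype.card G : ℂ) * finrank ℂ Fx).re = (Fintype.card G : ℝ) * finrank ℂ Fx := by
      norm_cast
    rw [h6] at h3
    have h7 : (0:ℝ) < Fintype.card G := by exact_mod_cast Fintype.card_pos
    have h8 := le_of_mul_le_mul_left h3 h7
    have : (finrank ℂ E : ℝ) ≤ finrank ℂ Fx + 2 * r := by linarith
    exact_mod_cast this
  have hadd := Submodule.finrank_add_finrank_orthogonal Fx
  have hO : ∀ g, ∀ w ∈ Fxᗮ, φ g w ∈ Fxᗮ := by
    intro g w hw
    apply (Submodule.mem_orthogonal _ _).2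
    intro u hu
    rw [← (hFx u).1 hu g, hinner]
    exact (Submodule.mem_orthogonal _ _).1 hw u hu
  let e := (stdOrthonormalBasis ℂ Fxᗮ).repr
  let ψ : G →* Module.End ℂ (EuclideanSpace ℂ (Fin (finrank ℂ Fxᗮ))) :=
    { toFun := fun g => e.toLinearEquiv.toLinearMap ∘ₗ (φ g).restrict (hO g) ∘ₗ
        e.symm.toLinearEquiv.toLinearMap
      map_one' := by
        ext1 v
        have : (LinearMap.restrict (φ 1) (hO 1)) (e.symm v) = e.symm v := by
          apply Subtype.ext; simp
        exact (congrArg e this).trans (e.apply_symm_apply v)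
      map_mul' := by
        intro x y
        refine LinearMap.ext fun v => ?_
        have : (LinearMap.restrict (φ (x * y)) (hO (x * y))) (e.symm v) =
            (LinearMap.restrict (φ x) (hO x)) ((LinearMap.restrict (φ y) (hO y)) (e.symm v)) := by
          apply Subtype.ext; simp
        have h2 : (LinearMap.restrict (φ y) (hO y)) (e.symm v) =
            e.symm (e ((LinearMap.restrict (φ y) (hO y)) (e.symm v))) :=
          (e.symm_apply_apply _).symm
        rw [h2] at this
        exact congrArg e this }
  have hψ : ∀ g v, ψ g v = e ((φ g).restrict (hO g) (e.symm v)) := fun g v => rfl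
  have hψiso : ∀ g v, ‖ψ g v‖ = ‖v‖ := by
    intro g v
    rw [hψ, LinearIsometryEquiv.norm_map]
    have : ‖(φ g).restrict (hO g) (e.symm v)‖ = ‖φ g (e.symm v : E)‖ := rfl
    rw [this, hiso]
    exact e.symm.norm_map v
  have hψinj : Function.Injective ψ := by
    intro g h hgh
    apply hinj
    have h1 : ∀ w ∈ Fxᗮ, φ g w = φ h w := by
      intro w hw
      have := LinearMap.congr_fun hgh (e ⟨w, hw⟩)
      rw [hψ, hψ] at this
      have := congrArg Subtype.val (e.injective this)
      simpa using this
    refine LinearMap.ext fun v => ?_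
    have hv : v ∈ Fx ⊔ Fxᗮ := by
      rw [Submodule.sup_orthogonal_of_hasOrthogonalProjection]; trivial
    obtain ⟨a, ha, b, hb, rfl⟩ := Submodule.mem_sup.1 hv
    rw [map_add, map_add, h1 b hb, (hFx a).1 ha, (hFx a).1 ha]
  obtain ⟨S, hS, hS2⟩ := hC _ G ψ hψiso hψinj (fun a b => near_commute ψ hψiso hψinj a b)
  refine ⟨S, hS.trans ?_, hS2⟩
  exact Finset.single_le_sum (f := C) (fun _ _ => Nat.zero_le _)
    (Finset.mem_range.2 (by omega))

/-- Unitary trick version. -/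
theorem linear_gen : ∃ F : ℕ → ℕ, ∀ (G : Type*) [Group G] [Finite G] (N : ℕ)
    (τ : G →* Module.End ℂ (EuclideanSpace ℂ (Fin N))), Function.Injective τ → ∀ r : ℕ,
    (∀ g, N ≤ finrank ℂ (LinearMap.ker (τ g - 1)) + r) →
    ∃ S : Finset G, S.card ≤ F r ∧ Subgroup.closure (S : Set G) = ⊤ := by
  obtain ⟨F, hF⟩ := unitary_gen
  refine ⟨F, ?_⟩
  intro G _ _ N τ hinj r hr
  have := Fintype.ofFinite G
  have hmul : ∀ x y : G, ∀ v, τ (x * y) v = τ x (τ y v) := fun x y v => by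
    rw [map_mul]; rfl
  let ι : EuclideanSpace ℂ (Fin N) →ₗ[ℂ] PiLp 2 (fun _ : G => EuclideanSpace ℂ (Fin N)) :=
    { toFun := fun v => WithLp.toLp 2 (fun g => τ g v)
      map_add' := fun x y => by ext; simp
      map_smul' := fun c x => by ext; simp }
  have hιap : ∀ v g, ι v g = τ g v := fun v g => rfl
  have hιinj : Function.Injective ι := by
    intro x y h
    have := congrArg (fun z => z 1) h
    simpa [hιap] using this
  let e := LinearEquiv.ofInjective ι hιinj
  have he : ∀ v, ((e v : LinearMap.range ι) : PiLp 2 (fun _ : G => EuclideanSpace ℂ (Fin N))) = ι v :=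
    fun v => rfl
  let φ : G →* Module.End ℂ (LinearMap.range ι) :=
    { toFun := fun g => e.toLinearMap ∘ₗ τ g ∘ₗ e.symm.toLinearMap
      map_one' := by ext1 v; simp
      map_mul' := by intro x y; ext1 v; simp }
  have hφ : ∀ g v, φ g v = e (τ g (e.symm v)) := fun g v => rfl
  apply hF G (LinearMap.range ι) φ _ _ r
  · intro g
    have h1 : finrank ℂ (LinearMap.range ι) = N := by
      rw [← e.finrank_eq]; simp
    have h2 : LinearMap.ker (φ g - 1) = (LinearMap.ker (τ g - 1)).map e.toLinearMap := by
      ext v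
      simp only [LinearMap.mem_ker, LinearMap.sub_apply, Module.End.one_apply, sub_eq_zero,
        Submodule.mem_map, hφ]
      constructor
      · intro h
        refine ⟨e.symm v, ?_, by simp⟩
        exact (LinearEquiv.eq_symm_apply _).2 h
      · rintro ⟨w, hw, rfl⟩
        simp [hw]
    rw [h1, h2, LinearEquiv.finrank_map_eq]
    exact hr g
  · intro g v
    obtain ⟨w, rfl⟩ := e.surjective v
    rw [hφ, e.symm_apply_apply]
    rw [Submodule.coe_norm, Submodule.coe_norm, he, he, PiLp.norm_eq_of_L2,
      PiLp.norm_eq_of_L2]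
    congr 1
    simp only [hιap, ← hmul]
    exact Fintype.sum_equiv (Equiv.mulRight g) _ _ (fun g => rfl)
  · intro g h hgh
    apply hinj
    refine LinearMap.ext fun v => ?_
    have := LinearMap.congr_fun hgh (e v)
    rw [hφ, hφ] at this
    simpa using this


theorem lift_step {R S : Type*} [Ring R] [Ring S] (π : R →+* S) (p : ℕ)
    (hker : ∀ x, π x = 0 → ∃ y, x = (p : R) * y) (hp0 : π p = 0)
    (hreg : ∀ x : R, (p : R) * x = 0 → x = 0) {U : Type*} [Group U] [Fintype U]
    (m : ℕ) (hm : ((m * Fintype.card U : ℕ) : S) = 1)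
    (ρ : U →* S) (k : ℕ) (hk : 1 ≤ k) (f : U → R) (hf : ∀ u, π (f u) = ρ u)
    (ε : U → U → R) (hε : ∀ g h, f (g * h) = f g * f h + (p : R) ^ k * ε g h) :
    ∃ (f' : U → R) (ε' : U → U → R), (∀ u, π (f' u) = ρ u) ∧
      ∀ g h, f' (g * h) = f' g * f' h + (p : R) ^ (k + 1) * ε' g h := by
  have hc : ∀ x : R, Commute (p : R) x := fun x => Nat.cast_commute p x
  have hck : ∀ j, ∀ x : R, x * (p : R) ^ j = (p : R) ^ j * x := fun j x =>
    ((hc x).pow_left j).eq.symm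
  have hregk : ∀ j, ∀ x : R, (p : R) ^ j * x = 0 → x = 0 := by
    intro j
    induction j with
    | zero => intro x hx; simpa using hx
    | succ j ih =>
      intro x hx
      rw [pow_succ, mul_assoc] at hx
      exact hreg x (ih _ hx)
  have hcoc : ∀ g h l, ε g h * f l + ε (g * h) l = f g * ε h l + ε g (h * l) := by
    intro g h l
    rw [← sub_eq_zero]
    apply hregk k
    have h1 := hε (g * h) l
    have h2 := hε g (h * l)
    rw [hε g h] at h1
    rw [hε h l, ← mul_assoc g h l, h1] at h2
    have h3 : f g * ((p : R) ^ k * ε h l) = (p : R) ^ k * (f g * ε h l) := by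
      rw [← mul_assoc, hck, mul_assoc]
    rw [mul_add, h3, add_mul] at h2
    have h4 : (p : R) ^ k * (ε g h * f l + ε (g * h) l - (f g * ε h l + ε g (h * l))) =
      (f g * f h * f l + (p : R) ^ k * ε g h * f l + (p : R) ^ k * ε (g * h) l) -
      (f g * (f h * f l) + (p : R) ^ k * (f g * ε h l) + (p : R) ^ k * ε g (h * l)) := by
      noncomm_ring
    rw [h4, h2, sub_self]
  let Δ : U → R := fun g => ∑ l, ε g l * f l⁻¹
  let δ : U → R := fun g => (m : R) * Δ g
  have hmod : ∀ g h, π (ε g h + δ (g * h) - f g * δ h - δ g * f h) = 0 := by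
    intro g h
    have h1 : ∀ l, π (ε g h) + π (ε (g * h) l * f l⁻¹) =
        ρ g * π (ε h l * f l⁻¹) + π (ε g (h * l)) * ρ ((h * l)⁻¹) * ρ h := by
      intro l
      have h2 := congrArg (fun x => π x * ρ l⁻¹) (hcoc g h l)
      simp only [map_add, map_mul, hf, add_mul] at h2
      rw [mul_assoc, ← map_mul ρ, mul_inv_cancel, map_one, mul_one] at h2
      simp only [map_mul, hf]
      rw [h2, mul_assoc (π (ε g (h * l))), ← map_mul ρ]
      have h3 : (h * l)⁻¹ * h = l⁻¹ := by group
      rw [h3]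
      simp only [mul_assoc]
    have h2 : (Fintype.card U : S) * π (ε g h) + π (Δ (g * h)) =
        ρ g * π (Δ h) + π (Δ g) * ρ h := by
      have := Finset.sum_congr (rfl : (Finset.univ : Finset U) = Finset.univ) (fun l _ => h1 l)
      rw [Finset.sum_add_distrib, Finset.sum_add_distrib, Finset.sum_const, Finset.card_univ,
        nsmul_eq_mul, ← Finset.mul_sum, ← Finset.sum_mul] at this
      have h4 : ∑ l, π (ε g (h * l)) * ρ ((h * l)⁻¹) = ∑ l, π (ε g l) * ρ (l⁻¹) :=
        Fintype.sum_equiv (Equiv.mulLeft h) _ _ (fun l => rfl)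
      rw [h4] at this
      simp only [Δ, map_sum]
      rw [this]
      simp only [map_mul, hf]
    have h5 : π (ε g h) = (m : S) * ((Fintype.card U : S) * π (ε g h)) := by
      rw [← mul_assoc, ← Nat.cast_mul, hm, one_mul]
    have h6 : (Fintype.card U : S) * π (ε g h) =
      ρ g * π (Δ h) + π (Δ g) * ρ h - π (Δ (g * h)) := by rw [← h2]; abel
    have h7 : ρ g * ((m : S) * π (Δ h)) = (m : S) * (ρ g * π (Δ h)) := by
      rw [← mul_assoc, ← (Nat.cast_commute m (ρ g)).eq, mul_assoc]
    simp only [map_sub, map_add, map_mul, hf, δ, map_natCast]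
    rw [h5, h6, h7]
    noncomm_ring
  choose η hη using fun g h => hker _ (hmod g h)
  obtain ⟨j, rfl⟩ : ∃ j, k = j + 1 := ⟨k - 1, by omega⟩
  refine ⟨fun g => f g + (p : R) ^ (j + 1) * δ g, fun g h => η g h - (p : R) ^ j * (δ g * δ h),
    ?_, ?_⟩
  · intro u
    simp [hf, hp0]
  · intro g h
    have e1 : f g * ((p : R) ^ (j + 1) * δ h) = (p : R) ^ (j + 1) * (f g * δ h) := by
      rw [← mul_assoc, hck, mul_assoc]
    have e2 : δ g * ((p : R) ^ (j + 1) * δ h) = (p : R) ^ (j + 1) * (δ g * δ h) := by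
      rw [← mul_assoc, hck, mul_assoc]
    have e3 : (p : R) ^ (j + 1 + 1) * η g h =
        (p : R) ^ (j + 1) * (ε g h + δ (g * h) - f g * δ h - δ g * f h) := by
      rw [hη, pow_succ _ (j + 1), mul_assoc]
    have e4 : (p : R) ^ (j + 1 + 1) * ((p : R) ^ j * (δ g * δ h)) =
        (p : R) ^ (j + 1) * ((p : R) ^ (j + 1) * (δ g * δ h)) := by
      simp only [← mul_assoc, ← pow_add]; congr 3; omega
    beta_reduce
    rw [hε, mul_sub, e3, e4, add_mul, mul_add, mul_add, e1, mul_assoc _ (δ g), mul_assoc _ (δ g), e2]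
    noncomm_ring

theorem lift_hom (p : ℕ) [Fact p.Prime] {U : Type*} [Group U] [Finite U]
    (hU : (Nat.card U).Coprime p) (N : ℕ) (ρ : U →* Matrix (Fin N) (Fin N) (ZMod p)) :
    ∃ σ : U →* Matrix (Fin N) (Fin N) ℤ_[p], ∀ u,
      (PadicInt.toZMod (p := p)).mapMatrix (σ u) = ρ u := by
  have := Fintype.ofFinite U
  let π : Matrix (Fin N) (Fin N) ℤ_[p] →+* Matrix (Fin N) (Fin N) (ZMod p) := (PadicInt.toZMod (p := p)).mapMatrix
  have hπap : ∀ x i j, π x i j = PadicInt.toZMod (x i j) := fun x i j => rfl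
  have hpmul : ∀ (k : ℕ) (x : Matrix (Fin N) (Fin N) ℤ_[p]) i j, ((p : Matrix (Fin N) (Fin N) ℤ_[p]) ^ k * x) i j = (p : ℤ_[p]) ^ k * x i j := by
    intro k x i j
    have : (p : Matrix (Fin N) (Fin N) ℤ_[p]) ^ k * x = ((p : ℤ_[p]) ^ k) • x := by
      rw [← Nat.cast_pow, ← nsmul_eq_mul, ← Nat.cast_pow, Nat.cast_smul_eq_nsmul]
    rw [this]; rfl
  have hpne : (p : ℤ_[p]) ≠ 0 := by exact_mod_cast (Fact.out : p.Prime).ne_zero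
  have hker : ∀ x, π x = 0 → ∃ y, x = (p : Matrix (Fin N) (Fin N) ℤ_[p]) * y := by
    intro x hx
    have : ∀ i j, ∃ y, x i j = (p : ℤ_[p]) * y := by
      intro i j
      have h1 : x i j ∈ RingHom.ker (PadicInt.toZMod (p := p)) := by
        rw [RingHom.mem_ker, ← hπap, hx]; rfl
      rw [PadicInt.ker_toZMod, PadicInt.maximalIdeal_eq_span_p, Ideal.mem_span_singleton] at h1
      exact h1
    choose y hy using this
    refine ⟨Matrix.of y, ?_⟩
    ext i j
    have := hpmul 1 (Matrix.of y) i j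
    rw [pow_one, pow_one] at this
    rw [this, hy]; rfl
  have hp0 : π (p : Matrix (Fin N) (Fin N) ℤ_[p]) = 0 := by
    rw [map_natCast]
    ext i j
    simp [Matrix.natCast_apply]
  have hreg : ∀ x : Matrix (Fin N) (Fin N) ℤ_[p], (p : Matrix (Fin N) (Fin N) ℤ_[p]) * x = 0 → x = 0 := by
    intro x hx
    ext i j
    have h1 := hpmul 1 x i j
    rw [pow_one, pow_one, hx] at h1
    rcases mul_eq_zero.1 h1.symm with h | h
    · exact absurd h hpne
    · exact h
  obtain ⟨m, hm⟩ : ∃ m : ℕ, ((m * Fintype.card U : ℕ) : ZMod p) = 1 := by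
    rw [Nat.card_eq_fintype_card] at hU
    refine ⟨((Fintype.card U : ZMod p)⁻¹).val, ?_⟩
    push_cast
    rw [ZMod.natCast_val, ZMod.cast_id', id, mul_comm]
    exact ZMod.coe_mul_inv_eq_one _ hU
  have hm' : ((m * Fintype.card U : ℕ) : Matrix (Fin N) (Fin N) (ZMod p)) = 1 := by
    have := congrArg (algebraMap (ZMod p) (Matrix (Fin N) (Fin N) (ZMod p))) hm
    rwa [map_natCast, map_one] at this
  -- the nested closed sets
  let X : ℕ → Set (U → Matrix (Fin N) (Fin N) ℤ_[p]) := fun (k : ℕ) => {f | (∀ u, π (f u) = ρ u) ∧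
    ∀ g h, ∀ i j, ‖(f (g * h) - f g * f h) i j‖ ≤ (p : ℝ) ^ (-(k : ℤ))}
  have hX : ∀ (k : ℕ) (f : U → Matrix (Fin N) (Fin N) ℤ_[p]), (∀ u, π (f u) = ρ u) → ((∀ g h, ∀ i j,
      ‖(f (g * h) - f g * f h) i j‖ ≤ (p : ℝ) ^ (-(k : ℤ))) ↔
      ∃ ε : U → U → Matrix (Fin N) (Fin N) ℤ_[p], ∀ g h, f (g * h) = f g * f h + (p : Matrix (Fin N) (Fin N) ℤ_[p]) ^ k * ε g h) := by
    intro k f hf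
    constructor
    · intro h
      have h1 : ∀ g h, ∀ i j, ∃ y, (f (g * h) - f g * f h) i j = (p : ℤ_[p]) ^ k * y := by
        intro g g' i j
        have := h g g' i j
        rw [PadicInt.norm_le_pow_iff_mem_span_pow, Ideal.mem_span_singleton] at this
        exact this
      choose y hy using h1
      refine ⟨fun g h => Matrix.of (y g h), fun g h => ?_⟩
      rw [← sub_eq_iff_eq_add']
      ext i j
      rw [hpmul, hy]; rfl
    · rintro ⟨ε, hε⟩ g h i j
      rw [PadicInt.norm_le_pow_iff_mem_span_pow, Ideal.mem_span_singleton]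
      refine ⟨ε g h i j, ?_⟩
      rw [← hpmul, hε, add_sub_cancel_left]
  have hp1 : (1 : ℝ) ≤ p := by exact_mod_cast (Fact.out : p.Prime).one_lt.le
  have hne : ∀ k, (X (k + 1)).Nonempty := by
    intro k
    induction k with
    | zero =>
      have hs : ∀ y : ZMod p, ∃ x : ℤ_[p], PadicInt.toZMod x = y := ZMod.ringHom_surjective _
      choose s hs using hs
      have hf : ∀ u, π ((fun u => Matrix.of fun i j => s (ρ u i j)) u) = ρ u := by
        intro u; ext i j; rw [hπap]; exact hs _
      generalize (fun u => Matrix.of fun i j => s (ρ u i j)) = f at hf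
      refine ⟨f, hf, (hX 1 _ hf).2 ?_⟩
      choose ε hε using fun g h => hker (f (g * h) - f g * f h)
          (by rw [map_sub, map_mul, hf, hf, hf, map_mul, sub_self])
      refine ⟨ε, fun g h => ?_⟩
      rw [pow_one, ← hε g h]
      abel
    | succ k ih =>
      obtain ⟨f, hf, hfd⟩ := ih
      obtain ⟨ε, hε⟩ := (hX _ f hf).1 hfd
      obtain ⟨f', ε', hf', hε'⟩ := lift_step π p hker hp0 hreg m hm' ρ (k + 1) (by omega) f hf ε hε
      exact ⟨f', hf', (hX _ f' hf').2 ⟨ε', hε'⟩⟩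
  have hred : ∀ x : ℤ_[p], ∀ y : ZMod p, IsClosed {x : ℤ_[p] | PadicInt.toZMod x = y} := by
    intro x y
    obtain ⟨s, hs⟩ := ZMod.ringHom_surjective (PadicInt.toZMod (p := p)) y
    have : {x : ℤ_[p] | PadicInt.toZMod x = y} = {x : ℤ_[p] | ‖x - s‖ ≤ (p:ℝ) ^ (-((1:ℕ) : ℤ))} := by
      ext x
      simp only [Set.mem_ofPred_eq]
      rw [PadicInt.norm_le_pow_iff_mem_span_pow, pow_one, ← PadicInt.maximalIdeal_eq_span_p,
        ← PadicInt.ker_toZMod, RingHom.mem_ker, map_sub, hs, sub_eq_zero]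
    rw [this]
    exact isClosed_le (by fun_prop) continuous_const
  have hcl : ∀ k, IsClosed (X k) := by
    intro k
    have : X k = (⋂ u, ⋂ i, ⋂ j, {f : U → Matrix (Fin N) (Fin N) ℤ_[p] | PadicInt.toZMod (f u i j) = ρ u i j}) ∩
      (⋂ g, ⋂ h, ⋂ i, ⋂ j, {f : U → Matrix (Fin N) (Fin N) ℤ_[p] | ‖(f (g * h) - f g * f h) i j‖ ≤ (p : ℝ) ^ (-(k : ℤ))}) := by
      ext f
      simp only [X, Set.mem_ofPred_eq, Set.mem_inter_iff, Set.mem_iInter]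
      refine and_congr ?_ Iff.rfl
      refine forall_congr' fun u => ?_
      rw [← Matrix.ext_iff]; rfl
    rw [this]
    refine IsClosed.inter ?_ ?_
    · refine isClosed_iInter fun u => isClosed_iInter fun i => isClosed_iInter fun j => ?_
      exact (hred 0 (ρ u i j)).preimage (f := fun f : U → Matrix (Fin N) (Fin N) ℤ_[p] => f u i j) (by fun_prop)
    · refine isClosed_iInter fun g => isClosed_iInter fun h => isClosed_iInter fun i =>
        isClosed_iInter fun j => ?_
      refine isClosed_le ?_ continuous_const
      simp only [Matrix.sub_apply, Matrix.mul_apply]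
      fun_prop
  have hcs : CompactSpace (U → Matrix (Fin N) (Fin N) ℤ_[p]) := by
    have : CompactSpace (Matrix (Fin N) (Fin N) ℤ_[p]) := inferInstanceAs (CompactSpace (Fin N → Fin N → ℤ_[p]))
    infer_instance
  obtain ⟨f, hf⟩ := IsCompact.nonempty_iInter_of_sequence_nonempty_isCompact_isClosed
    (fun k => X (k + 1)) (by
      intro k f hf
      refine ⟨hf.1, fun g h i j => (hf.2 g h i j).trans ?_⟩
      apply zpow_le_zpow_right₀ hp1
      push_cast; omega) hne (hcl _).isCompact (fun k => hcl _)
  rw [Set.mem_iInter] at hf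
  have hfmul : ∀ g h, f (g * h) = f g * f h := by
    intro g h
    rw [← sub_eq_zero]
    ext i j
    rw [Matrix.zero_apply, ← norm_le_zero_iff]
    have hlim : Filter.Tendsto (fun k : ℕ => ((p : ℝ)⁻¹) ^ (k + 1)) Filter.atTop (nhds 0) := by
      have hp2 : (1 : ℝ) < p := by exact_mod_cast (Fact.out : p.Prime).one_lt
      exact (tendsto_pow_atTop_nhds_zero_of_lt_one (by positivity)
        (inv_lt_one_of_one_lt₀ hp2)).comp (Filter.tendsto_add_atTop_nat 1)
    refine ge_of_tendsto' hlim fun k => ?_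
    have := (hf k).2 g h i j
    rwa [zpow_neg, zpow_natCast, ← inv_pow] at this
  have hred := (hf 0).1
  -- f 1 is idempotent and reduces to 1, so det is a unit
  have hf1 : f 1 = 1 := by
    have hunit : IsUnit (f 1) := by
      rw [Matrix.isUnit_iff_isUnit_det]
      have h1 : PadicInt.toZMod (f 1).det = 1 := by
        rw [RingHom.map_det]
        have := hred 1
        rw [map_one] at this
        change (π (f 1)).det = 1
        rw [this, Matrix.det_one]
      by_contra hnu
      have : (f 1).det ∈ IsLocalRing.maximalIdeal ℤ_[p] := (IsLocalRing.mem_maximalIdeal _).2 hnu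
      rw [← PadicInt.ker_toZMod, RingHom.mem_ker, h1] at this
      exact one_ne_zero this
    have h2 := hfmul 1 1
    rw [mul_one] at h2
    exact hunit.mul_left_cancel (by rw [← h2, mul_one])
  exact ⟨⟨⟨f, hf1⟩, hfmul⟩, hred⟩

theorem exists_embedding (p : ℕ) [Fact p.Prime] : ∃ i : ℤ_[p] →+* ℂ, Function.Injective i := by
  have h1 : Cardinal.mk ℚ_[p] = Cardinal.continuum := by
    apply le_antisymm
    · have : Cardinal.mk ℚ_[p] ≤ Cardinal.mk (CauSeq ℚ (padicNorm p)) := Cardinal.mk_quotient_le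
      refine this.trans ?_
      refine (Cardinal.mk_subtype_le _).trans ?_
      simp
    · exact continuum_le_cardinal_of_nontriviallyNormedField _
  have h2 : Cardinal.mk (AlgebraicClosure ℚ_[p]) = Cardinal.continuum := by
    apply le_antisymm
    · refine (Algebra.IsAlgebraic.cardinalMk_le_max ℚ_[p] _).trans ?_
      rw [h1]; simp [Cardinal.aleph0_le_continuum]
    · rw [← h1]
      exact Cardinal.mk_le_of_injective (algebraMap ℚ_[p] (AlgebraicClosure ℚ_[p])).injective
  have : CharZero (AlgebraicClosure ℚ_[p]) := inferInstance
  have h3 : Nonempty (AlgebraicClosure ℚ_[p] ≃+* ℂ) := by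
    apply IsAlgClosed.ringEquiv_of_equiv_of_charZero
    · rw [h2]; exact Cardinal.aleph0_lt_continuum
    · rw [← Cardinal.eq, h2, Cardinal.mk_complex]
  obtain ⟨e⟩ := h3
  refine ⟨(e.toRingHom.comp (algebraMap ℚ_[p] (AlgebraicClosure ℚ_[p]))).comp
    (PadicInt.Coe.ringHom), ?_⟩
  intro x y hxy
  have := e.injective hxy
  exact Subtype.ext ((algebraMap ℚ_[p] (AlgebraicClosure ℚ_[p])).injective this)

/-- Fixed spaces do not shrink when a coprime automorphism is lifted to characteristic zero. -/
theorem fixed_lift (p : ℕ) [Fact p.Prime] (i : ℤ_[p] →+* ℂ) (hi : Function.Injective i)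
    (N : ℕ) (A : Matrix (Fin N) (Fin N) ℤ_[p]) (o : ℕ) (ho : o.Coprime p) (hA : A ^ o = 1) :
    finrank (ZMod p) (LinearMap.ker
        (Matrix.toLin' ((PadicInt.toZMod (p := p)).mapMatrix A) - 1)) ≤
      finrank ℂ (LinearMap.ker (Matrix.toLin' (i.mapMatrix A) - 1)) := by
  classical
  set π := (PadicInt.toZMod (p := p)) with hπ
  set A0 := π.mapMatrix A with hA0
  set K := LinearMap.ker (Matrix.toLin' A0 - 1) with hK
  set k := finrank (ZMod p) K with hk
  have hsurj : Function.Surjective π := ZMod.ringHom_surjective π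
  let b := finBasis (ZMod p) K
  let w : (Fin k → ZMod p) →ₗ[ZMod p] (Fin N → ZMod p) :=
    K.subtype ∘ₗ b.equivFun.symm.toLinearMap
  have hwinj : LinearMap.ker w = ⊥ := by
    rw [LinearMap.ker_eq_bot]
    exact K.injective_subtype.comp b.equivFun.symm.injective
  obtain ⟨l, hl⟩ := LinearMap.exists_leftInverse_of_injective w hwinj
  set W0 := LinearMap.toMatrix' w with hW0
  set L0 := LinearMap.toMatrix' l with hL0
  have hLW : L0 * W0 = 1 := by
    rw [hL0, hW0, ← LinearMap.toMatrix'_comp, hl, LinearMap.toMatrix'_id]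
  have hAW : A0 * W0 = W0 := by
    have : (Matrix.toLin' A0) ∘ₗ w = w := by
      ext1 x
      apply LinearMap.ext
      intro c
      have h1 : w (LinearMap.single (ZMod p) (fun _ => ZMod p) x c) ∈ K := by
        exact (b.equivFun.symm _).2
      rw [hK, LinearMap.mem_ker, LinearMap.sub_apply, sub_eq_zero] at h1
      exact h1
    have h2 := congrArg LinearMap.toMatrix' this
    rwa [LinearMap.toMatrix'_comp, LinearMap.toMatrix'_toLin'] at h2
  choose s hs using hsurj
  let W1 : Matrix (Fin N) (Fin k) ℤ_[p] := W0.map s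
  let L1 : Matrix (Fin k) (Fin N) ℤ_[p] := L0.map s
  have hW1 : W1.map π = W0 := by ext a c; simp [W1, hs]
  have hL1 : L1.map π = L0 := by ext a c; simp [L1, hs]
  obtain ⟨m, hm⟩ : ∃ m : ZMod p, m * (o : ZMod p) = 1 :=
    ⟨_, ZMod.inv_mul_of_unit _ ((ZMod.isUnit_iff_coprime o p).2 ho)⟩
  let T : Matrix (Fin N) (Fin N) ℤ_[p] := ∑ j ∈ Finset.range o, A ^ j
  let W : Matrix (Fin N) (Fin k) ℤ_[p] := s m • (T * W1)
  have hTA : A * T = T := by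
    have := mul_geom_sum A o
    rw [hA, sub_self, sub_mul, one_mul, sub_eq_zero] at this
    exact this
  have hAWl : A * W = W := by
    simp only [W]
    rw [Matrix.mul_smul, ← Matrix.mul_assoc, hTA]
  have hpow : ∀ j : ℕ, A0 ^ j * W0 = W0 := by
    intro j
    induction j with
    | zero => simp
    | succ j ih => rw [pow_succ, Matrix.mul_assoc, hAW, ih]
  have hWred : W.map π = W0 := by
    have h1 : W.map π = m • ((π.mapMatrix T) * W1.map π) := by
      rw [RingHom.mapMatrix_apply, ← Matrix.map_mul]
      ext a c
      simp only [W, Matrix.map_apply, Matrix.smul_apply, smul_eq_mul, map_mul, hs]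
    rw [h1, hW1, map_sum, Matrix.sum_mul]
    simp only [map_pow, ← hA0, hpow, Finset.sum_const, Finset.card_range]
    rw [← Nat.cast_smul_eq_nsmul (ZMod p), smul_smul, hm, one_smul]
  have hdet : (L1 * W).det ≠ 0 := by
    intro h0
    have h1 : π (L1 * W).det = 1 := by
      rw [RingHom.map_det, RingHom.mapMatrix_apply, Matrix.map_mul, hL1, hWred, hLW,
        Matrix.det_one]
    rw [h0, map_zero] at h1
    exact zero_ne_one h1
  have hdetC : ((L1.map i) * (W.map i)).det ≠ 0 := by
    rw [← Matrix.map_mul, ← RingHom.mapMatrix_apply, ← RingHom.map_det]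
    intro h
    exact hdet (hi (by rw [h, map_zero]))
  have hAWC : (i.mapMatrix A) * (W.map i) = W.map i := by
    rw [RingHom.mapMatrix_apply, ← Matrix.map_mul, hAWl]
  let wc : (Fin k → ℂ) →ₗ[ℂ] (Fin N → ℂ) := Matrix.toLin' (W.map i)
  have hker : ∀ x, wc x ∈ LinearMap.ker (Matrix.toLin' (i.mapMatrix A) - 1) := by
    intro x
    rw [LinearMap.mem_ker, LinearMap.sub_apply, sub_eq_zero]
    simp only [wc, Matrix.toLin'_apply, Matrix.mulVec_mulVec, hAWC, Module.End.one_apply]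
  have hinj : Function.Injective (wc.codRestrict _ hker) := by
    intro x y hxy
    have h1 : wc x = wc y := congrArg Subtype.val hxy
    have h2 : ((L1.map i) * (W.map i)).mulVec x = ((L1.map i) * (W.map i)).mulVec y := by
      rw [← Matrix.mulVec_mulVec, ← Matrix.mulVec_mulVec]
      exact congrArg _ h1
    exact Matrix.mulVec_injective_iff_isUnit.2
      ((Matrix.isUnit_iff_isUnit_det _).2 (isUnit_iff_ne_zero.2 hdetC)) h2
  have := LinearMap.finrank_le_finrank_of_injective hinj
  simpa using this

theorem modular_gen : ∃ F : ℕ → ℕ, ∀ (p : ℕ) [Fact p.Prime] (G : Type*) [Group G] [Finite G]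
    (_ : (Nat.card G).Coprime p) (N : ℕ) (ρ : G →* Matrix (Fin N) (Fin N) (ZMod p)),
    Function.Injective ρ → ∀ r : ℕ,
    (∀ g, N ≤ finrank (ZMod p) (LinearMap.ker (Matrix.toLin' (ρ g) - 1)) + r) →
    ∃ S : Finset G, S.card ≤ F r ∧ Subgroup.closure (S : Set G) = ⊤ := by
  obtain ⟨F, hF⟩ := linear_gen
  refine ⟨F, ?_⟩
  intro p _ G _ _ hc N ρ hρ r hr
  obtain ⟨i, hi⟩ := exists_embedding p
  obtain ⟨σ, hσ⟩ := lift_hom p hc N ρ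
  let e : EuclideanSpace ℂ (Fin N) ≃ₗ[ℂ] (Fin N → ℂ) := WithLp.linearEquiv 2 ℂ (Fin N → ℂ)
  let c : Module.End ℂ (Fin N → ℂ) →* Module.End ℂ (EuclideanSpace ℂ (Fin N)) :=
    { toFun := fun f => e.symm.toLinearMap ∘ₗ f ∘ₗ e.toLinearMap
      map_one' := by ext1 x; simp
      map_mul' := fun f g => by ext1 x; simp }
  let τ : G →* Module.End ℂ (EuclideanSpace ℂ (Fin N)) :=
    { toFun := fun g => c (Matrix.toLin' (i.mapMatrix (σ g)))
      map_one' := by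
        rw [map_one, map_one, Matrix.toLin'_one]
        exact c.map_one
      map_mul' := fun g h => by
        rw [map_mul, map_mul, Matrix.toLin'_mul]
        exact c.map_mul _ _ }
  have hτ : ∀ g x, τ g x = e.symm (Matrix.toLin' (i.mapMatrix (σ g)) (e x)) := fun g x => rfl
  refine hF G N τ ?_ r ?_
  · intro g h hgh
    apply hρ
    rw [← hσ, ← hσ]
    congr 1
    have h1 : Matrix.toLin' (i.mapMatrix (σ g)) = Matrix.toLin' (i.mapMatrix (σ h)) := by
      apply LinearMap.ext
      intro x
      have := LinearMap.congr_fun hgh (e.symm x)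
      rw [hτ, hτ] at this
      simpa using e.symm.injective this
    have h2 := Matrix.toLin'.injective h1
    exact Matrix.map_injective hi h2
  · intro g
    have h1 := fixed_lift p i hi N (σ g) (orderOf g)
      (Nat.Coprime.coprime_dvd_left (orderOf_dvd_natCard g) hc)
      (by rw [← map_pow, pow_orderOf_eq_one, map_one])
    rw [hσ] at h1
    have h2 : finrank ℂ (LinearMap.ker (Matrix.toLin' (i.mapMatrix (σ g)) - 1)) ≤
        finrank ℂ (LinearMap.ker (τ g - 1)) := by
      let f := (e.symm.toLinearMap ∘ₗ
        (LinearMap.ker (Matrix.toLin' (i.mapMatrix (σ g)) - 1)).subtype)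
      have hf : ∀ x, f x ∈ LinearMap.ker (τ g - 1) := by
        intro x
        have hx := x.2
        rw [LinearMap.mem_ker, LinearMap.sub_apply, sub_eq_zero] at hx ⊢
        rw [hτ]
        simp only [f, LinearMap.comp_apply, Submodule.subtype_apply, LinearEquiv.coe_coe,
          LinearEquiv.apply_symm_apply]
        rw [hx]
        rfl
      refine LinearMap.finrank_le_finrank_of_injective (f := f.codRestrict _ hf) ?_
      intro x y hxy
      have : f x = f y := congrArg Subtype.val hxy
      exact Subtype.ext (e.symm.injective this)
    have := hr g
    omega

/-- Additive endomorphisms of a `ZMod p`-module are linear. -/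
def zmodEndHom (p : ℕ) (W : Type*) [AddCommGroup W] [Module (ZMod p) W] :
    AddMonoid.End W →* Module.End (ZMod p) W where
  toFun := fun f => AddMonoidHom.toZModLinearMap p f
  map_one' := LinearMap.ext fun x => rfl
  map_mul' := fun u v => LinearMap.ext fun x => rfl

/-- Matrix representation of a group acting on a finite `ZMod p`-module. -/
theorem exists_rep_aux (p : ℕ) [Fact p.Prime] (W : Type*) [AddCommGroup W] [Module (ZMod p) W]
    [Finite W] {G : Type*} [Group G] (ψ : G →* AddMonoid.End W) (hψ : Function.Injective ψ) :
    ∃ (N : ℕ) (ρ : G →* Matrix (Fin N) (Fin N) (ZMod p)), Function.Injective ρ ∧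
      ∀ u r, (∃ S : Finset W, S.card ≤ r ∧
          ∀ x, ψ u x - x ∈ AddSubgroup.closure (S : Set W)) →
        N ≤ finrank (ZMod p) (LinearMap.ker (Matrix.toLin' (ρ u) - 1)) + r := by
  classical
  have : Module.Finite (ZMod p) W := Module.Finite.of_finite
  let φ : G →* Module.End (ZMod p) W := (zmodEndHom p W).comp ψ
  have hφ : ∀ (u : G) (x : W), φ u x = ψ u x := fun _ _ => rfl
  let b := finBasis (ZMod p) W
  let e := b.equivFun
  let μ : Module.End (ZMod p) W →* Matrix _ _ (ZMod p) :=
    { toFun := fun f => LinearMap.toMatrixAlgEquiv b f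
      map_one' := map_one _
      map_mul' := map_mul _ }
  refine ⟨finrank (ZMod p) W, μ.comp φ, ?_, ?_⟩
  · intro u v huv
    have h1 : φ u = φ v := (LinearMap.toMatrixAlgEquiv b).injective huv
    apply hψ
    ext x
    exact LinearMap.congr_fun h1 x
  · intro u r hr
    obtain ⟨S, hS, hcl⟩ := hr
    set M := μ.comp φ u with hM
    have hMe : ∀ x, Matrix.toLin' M (e x) = e (φ u x) := by
      intro x
      have h1 : M = LinearMap.toMatrix b b (φ u) := rfl
      rw [Matrix.toLin'_apply, h1]
      exact LinearMap.toMatrix_mulVec_repr b b (φ u) x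
    have hrange : LinearMap.range (φ u - 1) ≤ Submodule.span (ZMod p) (S : Set W) := by
      rintro _ ⟨x, rfl⟩
      have h2 : AddSubgroup.closure (S : Set W) ≤
          (Submodule.span (ZMod p) (S : Set W)).toAddSubgroup := by
        rw [AddSubgroup.closure_le]
        exact Submodule.subset_span
      exact h2 (hcl x)
    have hfr : finrank (ZMod p) (LinearMap.range (φ u - 1)) ≤ r :=
      (Submodule.finrank_mono hrange).trans ((finrank_span_finset_le_card S).trans hS)
    have hrn := LinearMap.finrank_range_add_finrank_ker (φ u - 1)
    have hk : finrank (ZMod p) (LinearMap.ker (φ u - 1)) ≤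
        finrank (ZMod p) (LinearMap.ker (Matrix.toLin' M - 1)) := by
      let f := e.toLinearMap ∘ₗ (LinearMap.ker (φ u - 1)).subtype
      have hf : ∀ x, f x ∈ LinearMap.ker (Matrix.toLin' M - 1) := by
        intro x
        have hx := x.2
        rw [LinearMap.mem_ker, LinearMap.sub_apply, sub_eq_zero] at hx ⊢
        have h3 : f x = e x := rfl
        rw [h3, hMe, hx]
        rfl
      refine LinearMap.finrank_le_finrank_of_injective (f := f.codRestrict _ hf) ?_
      intro x y hxy
      have : f x = f y := congrArg Subtype.val hxy
      exact Subtype.ext (e.injective this)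
    omega

/-- Matrix representation of the automorphism group of an elementary abelian group. -/
theorem exists_rep (p : ℕ) [Fact p.Prime] (V : Type*) [CommGroup V] [Finite V]
    (hV : ∀ v : V, v ^ p = 1) :
    ∃ (N : ℕ) (ρ : MulAut V →* Matrix (Fin N) (Fin N) (ZMod p)), Function.Injective ρ ∧
      ∀ u r, rankLe (autCommutator u) r →
        N ≤ finrank (ZMod p) (LinearMap.ker (Matrix.toLin' (ρ u) - 1)) + r := by
  classical
  let inst : Module (ZMod p) (Additive V) := AddCommGroup.zmodModule (n := p) (fun x => by
    have := hV x.toMul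
    exact congrArg Additive.ofMul this)
  have hfin : Finite (Additive V) := ‹Finite V›
  let ψ : MulAut V →* AddMonoid.End (Additive V) :=
    { toFun := fun u => MonoidHom.toAdditive u.toMonoidHom
      map_one' := rfl
      map_mul' := fun u v => rfl }
  have hψ : Function.Injective ψ := by
    intro u v huv
    ext x
    exact congrArg Additive.toMul (DFunLike.congr_fun huv (Additive.ofMul x))
  obtain ⟨N, ρ, hρ, h⟩ := exists_rep_aux p (Additive V) ψ hψ
  refine ⟨N, ρ, hρ, fun u r hr => h u r ?_⟩
  obtain ⟨S, hS, hcl⟩ := hr ⊤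
  refine ⟨S.image fun s : autCommutator u => Additive.ofMul (s : V), Finset.card_image_le.trans hS, ?_⟩
  have hz : ∀ z ∈ Subgroup.closure (S : Set (autCommutator u)), Additive.ofMul (z : V) ∈
      AddSubgroup.closure
        ((S.image fun s : autCommutator u => Additive.ofMul (s : V) : Finset (Additive V)) : Set (Additive V)) := by
    intro z hz
    induction hz using Subgroup.closure_induction with
    | mem x hx =>
      exact AddSubgroup.subset_closure (Finset.mem_coe.2 (Finset.mem_image_of_mem _ hx))
    | one => exact AddSubgroup.zero_mem _
    | mul x y _ _ hx hy => exact AddSubgroup.add_mem _ hx hy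
    | inv x _ hx => exact AddSubgroup.neg_mem _ hx
  intro x
  have hmem : (x.toMul)⁻¹ * u x.toMul ∈ autCommutator u := Subgroup.subset_closure ⟨_, rfl⟩
  have h1 := hz ⟨_, hmem⟩ (by rw [hcl]; trivial)
  have h2 : ψ u x - x = Additive.ofMul ((x.toMul)⁻¹ * u x.toMul) := by
    rw [mul_comm, ← div_eq_mul_inv]
    rfl
  rw [h2]
  exact h1
end RankAux

/-- **Lemma 2.8.** Let `V` be an elementary abelian finite `p`-group, `U` a group of coprime
automorphisms of `V`, and `r` a positive integer. If the rank of `[V,u]` is at most `r` for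
every `u ∈ U`, then the rank of `U` is bounded in terms of `r`. -/
theorem statement_7 :
    ∃ f : ℕ → ℕ,
      ∀ (p : ℕ), p.Prime →
        ∀ (V : Type u) [CommGroup V] [Finite V], (∀ v : V, v ^ p = 1) →
          ∀ (U : Subgroup (MulAut V)) (r : ℕ), 0 < r →
            (Nat.card U).Coprime p →
            (∀ u ∈ U, rankLe (autCommutator u) r) →
            rankLe U (f r) := by
  classical
  obtain ⟨F, hF⟩ := RankAux.modular_gen.{u}
  refine ⟨F, ?_⟩
  intro p hp V _ _ hV U r _ hc hu K
  have : Fact p.Prime := ⟨hp⟩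
  have : Finite (MulAut V) := Finite.of_injective (fun u : MulAut V => (u : V → V))
    DFunLike.coe_injective
  obtain ⟨N, ρ, hρ, hr⟩ := RankAux.exists_rep p V hV
  obtain ⟨S, hS, hcl⟩ := hF p K (Nat.Coprime.coprime_dvd_left (Subgroup.card_subgroup_dvd_card K) hc)
    N (ρ.comp (U.subtype.comp K.subtype))
    (hρ.comp (U.subtype_injective.comp K.subtype_injective)) r
    (fun g => hr _ r (hu _ g.1.2))
  refine ⟨S.image K.subtype, Finset.card_image_le.trans hS, ?_⟩
  rw [Finset.coe_image, ← MonoidHom.map_closure, hcl, ← MonoidHom.range_eq_map,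
    Subgroup.range_subtype]
end

section
/- Let V be an elementary abelian finite p-group and let U be an abelian group of automorphisms of V with gcd(|U|, p) = 1, and let r be a positive integer. If for every u ∈ U the subgroup [V, u] has rank at most r, then the rank of U is bounded in terms of r alone. -/
universe u

theorem aux_unip {R M : Type*} [CommRing R] [AddCommGroup M] [Module R M] (p N : ℕ)
    (hN : N.Coprime p) (x : R) (v d : M) (hd : x • v = v + d) (hxd : x • d = d)
    (hp : p • d = 0) (hxN : x ^ N • v = v) : d = 0 := by
  have h : ∀ n : ℕ, x ^ n • v = v + n • d := by
    intro n
    induction n with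
    | zero => simp
    | succ k ih =>
      rw [pow_succ', mul_smul, ih, smul_add, hd, smul_comm, hxd, succ_nsmul]
      abel
  have h1 : N • d = 0 := by
    have := h N
    rw [hxN] at this
    simpa using this.symm
  have h2 : addOrderOf d ∣ 1 := by
    rw [← hN]
    exact Nat.dvd_gcd (addOrderOf_dvd_of_nsmul_eq_zero h1) (addOrderOf_dvd_of_nsmul_eq_zero hp)
  simpa using h2

theorem aux_gen {R G : Type*} [CommRing R] [CommGroup G] [Finite G] (φ : G →* R) (p : ℕ)
    (hp : p.Prime) (hG : (Nat.card G).Coprime p) (n : ℕ) :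
    ∀ (M : Type u) [AddCommGroup M] [Module R M] [Finite M], (∀ m : M, p • m = 0) →
      Nat.card M ≤ p ^ n → ∀ K : Subgroup G,
      (∀ k ∈ K, (∀ m : M, φ k • m = m) → k = 1) →
      ∃ S : Finset G, S.card ≤ n ∧ Subgroup.closure (S : Set G) = K := by
  classical
  induction n with
  | zero =>
    intro M _ _ _ hM hc K hK
    refine ⟨∅, by simp, ?_⟩
    have : Subsingleton M := Finite.card_le_one_iff_subsingleton.mp (by simpa using hc)
    simp only [Finset.coe_empty, Subgroup.closure_empty]
    symm
    rw [Subgroup.eq_bot_iff_forall]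
    intro k hk
    exact hK k hk fun m => Subsingleton.elim _ _
  | succ n ih =>
    intro M _ _ _ hM hc K hK
    rcases subsingleton_or_nontrivial M with hs | hs
    · refine ⟨∅, by simp, ?_⟩
      simp only [Finset.coe_empty, Subgroup.closure_empty]
      symm
      rw [Subgroup.eq_bot_iff_forall]
      intro k hk
      exact hK k hk fun m => Subsingleton.elim _ _
    obtain ⟨W, hW⟩ := IsAtomic.exists_atom (Submodule R M)
    have hsimple : IsSimpleModule R W := isSimpleModule_iff_isAtom.mpr hW
    have hmax : (Module.annihilator R W).IsMaximal := IsSimpleModule.annihilator_isMaximal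
    set I := Module.annihilator R W with hI
    let f : G →* (R ⧸ I)ˣ := ((Ideal.Quotient.mk I : R →* R ⧸ I).comp φ).toHomUnits
    have hf : ∀ g, ((f g : (R ⧸ I)ˣ) : R ⧸ I) = Ideal.Quotient.mk I (φ g) := fun g => rfl
    have hfin : Finite (K.map f) := by
      have : Finite ((K : Set G).image f) := Set.Finite.to_subtype (Set.toFinite _)
      exact this
    have hcyc : IsCyclic (K.map f) := isCyclic_subgroup_units _
    obtain ⟨⟨c, hcK⟩, hgen⟩ := hcyc.exists_generator
    obtain ⟨g, hgK, rfl⟩ := hcK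
    -- card bound
    have hWcard : p ≤ Nat.card W := by
      haveI : Nontrivial W := IsSimpleModule.nontrivial R W
      obtain ⟨w, hw⟩ := exists_ne (0 : W)
      haveI := Fact.mk hp
      have : addOrderOf w = p := addOrderOf_eq_prime (by ext; simpa using hM w) hw
      rw [← this]
      exact Nat.le_of_dvd Nat.card_pos (addOrderOf_dvd_natCard w)
    have hcard : Nat.card (M ⧸ W) ≤ p ^ n := by
      have h1 : Nat.card M = Nat.card (M ⧸ W) * Nat.card W :=
        AddSubgroup.card_eq_card_quotient_mul_card_addSubgroup W.toAddSubgroup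
      have h2 : Nat.card (M ⧸ W) * p ≤ p ^ n * p := by
        rw [← pow_succ]
        exact (Nat.mul_le_mul_left _ hWcard).trans (h1 ▸ hc)
      exact Nat.le_of_mul_le_mul_right h2 hp.pos
    have hann : ∀ k, f k = 1 → ∀ w ∈ W, φ k • w = w := by
      intro k hk w hw
      have h1 : Ideal.Quotient.mk I (φ k) = Ideal.Quotient.mk I 1 := by
        rw [← hf, hk]; simp
      rw [Ideal.Quotient.eq] at h1
      have h2 := Module.mem_annihilator.mp h1 ⟨w, hw⟩
      have h3 : (φ k - 1) • w = 0 := congrArg Subtype.val h2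
      rw [sub_smul, one_smul, sub_eq_zero] at h3
      exact h3
    haveI : Finite (M ⧸ W) := Finite.of_surjective _ (Submodule.Quotient.mk_surjective W)
    obtain ⟨S, hS, hSK⟩ := ih (M ⧸ W) (fun m => by
        obtain ⟨m, rfl⟩ := Submodule.Quotient.mk_surjective W m
        rw [← Submodule.Quotient.mk_smul, hM, Submodule.Quotient.mk_zero]) hcard (K ⊓ f.ker) (by
      rintro k ⟨hkK, hkf⟩ hk
      refine hK k hkK fun m => ?_
      have h1 : φ k • m - m ∈ W := by
        rw [← Submodule.Quotient.eq, Submodule.Quotient.mk_smul]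
        exact hk _
      have := aux_unip p (Nat.card G) hG (φ k) m (φ k • m - m) (by abel)
        (hann k hkf _ h1) (hM _) (by rw [← map_pow, pow_card_eq_one']; simp)
      exact sub_eq_zero.mp this)
    refine ⟨insert g S, (Finset.card_insert_le _ _).trans (by omega), ?_⟩
    apply le_antisymm
    · rw [Subgroup.closure_le]
      intro x hx
      rcases Finset.mem_insert.mp (Finset.mem_coe.mp hx) with rfl | hx
      · exact hgK
      · have : x ∈ K ⊓ f.ker := hSK ▸ Subgroup.subset_closure hx
        exact this.1
    · intro k hk
      obtain ⟨z, hz⟩ := Subgroup.mem_zpowers_iff.mp (hgen ⟨f k, k, hk, rfl⟩)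
      have hz' : f g ^ z = f k := congrArg Subtype.val hz
      have h1 : (g ^ z)⁻¹ * k ∈ K ⊓ f.ker := by
        refine ⟨K.mul_mem (K.inv_mem (K.zpow_mem hgK z)) hk, ?_⟩
        change f _ = 1
        rw [map_mul, map_inv, map_zpow, hz', inv_mul_cancel]
      have h2 : (g ^ z)⁻¹ * k ∈ Subgroup.closure ((insert g S : Finset G) : Set G) := by
        rw [← hSK] at h1
        exact Subgroup.closure_mono (by simp) h1
      have h3 : g ^ z ∈ Subgroup.closure ((insert g S : Finset G) : Set G) :=
        Subgroup.zpow_mem _ (Subgroup.subset_closure (by simp)) z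
      simpa using Subgroup.mul_mem _ h3 h2

theorem aux_main {R G : Type*} [CommRing R] [CommGroup G] [Finite G] (φ : G →* R) (p : ℕ)
    (hp : p.Prime) (hG : (Nat.card G).Coprime p) (r : ℕ)
    (M : Type u) [AddCommGroup M] [Module R M] [Finite M] (hM : ∀ m : M, p • m = 0)
    (hfaith : ∀ k, (∀ m : M, φ k • m = m) → k = 1)
    (hr : ∀ g : G, Nat.card (LinearMap.range (LinearMap.lsmul R M (φ g - 1))) ≤ p ^ r)
    (K : Subgroup G) :
    ∃ S : Finset G, S.card ≤ r ∧ Subgroup.closure (S : Set G) = K := by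
  have hN : ∀ g (m : M), φ g ^ Nat.card G • m = m := fun g m => by
    rw [← map_pow, pow_card_eq_one']; simp
  obtain ⟨u, hu⟩ := Finite.exists_max
    (fun g : G => Nat.card (LinearMap.range (LinearMap.lsmul R M (φ g - 1))))
  set W := LinearMap.range (LinearMap.lsmul R M (φ u - 1)) with hW
  have hmemW : ∀ m : M, (φ u - 1) • m ∈ W := fun m => ⟨m, rfl⟩
  -- (u - 1) is surjective on W
  have hsurj : ∀ w ∈ W, ∃ w' ∈ W, (φ u - 1) • w' = w := by
    let T : W →ₗ[R] W := LinearMap.lsmul R W (φ u - 1)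
    have hinj : Function.Injective T := by
      rw [← LinearMap.ker_eq_bot, LinearMap.ker_eq_bot']
      rintro ⟨w, v, hv⟩ hw
      have h1 : (φ u - 1) • w = 0 := congrArg Subtype.val hw
      have h2 : (φ u - 1) • v = w := hv
      rw [sub_smul, one_smul, sub_eq_zero] at h1
      rw [sub_smul, one_smul, sub_eq_iff_eq_add'] at h2
      ext
      exact aux_unip p (Nat.card G) hG (φ u) v w h2 h1 (hM _) (hN _ _)
    intro w hw
    obtain ⟨w', h⟩ := Finite.surjective_of_injective hinj ⟨w, hw⟩
    exact ⟨w', w'.2, congrArg Subtype.val h⟩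
  refine aux_gen φ p hp hG r W (fun m => by ext; simpa using hM m) (hr u) K ?_
  intro k _ hk
  have hk' : ∀ w ∈ W, φ k • w = w := fun w hw => congrArg Subtype.val (hk ⟨w, hw⟩)
  have hle : W ≤ LinearMap.range (LinearMap.lsmul R M (φ (u * k) - 1)) := by
    intro w hw
    obtain ⟨w', hw', rfl⟩ := hsurj w hw
    refine ⟨w', ?_⟩
    change (φ (u * k) - 1) • w' = _
    rw [map_mul, sub_smul, mul_smul, hk' w' hw', sub_smul]
  have heq : W = LinearMap.range (LinearMap.lsmul R M (φ (u * k) - 1)) := by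
    apply SetLike.coe_injective
    apply Set.eq_of_subset_of_ncard_le hle
    exact hu (u * k)
  apply hfaith
  intro m
  have h1 : (φ (u * k) - 1) • m ∈ W := heq ▸ ⟨m, rfl⟩
  have h2 : φ u • (φ k • m - m) ∈ W := by
    have := W.sub_mem h1 (hmemW m)
    convert this using 1
    rw [map_mul, sub_smul, sub_smul, mul_smul, smul_sub]
    abel
  have h3 : φ k • m - m ∈ W := by
    have := W.smul_mem (φ u⁻¹) h2
    rwa [← mul_smul, ← map_mul, inv_mul_cancel, map_one, one_smul] at this
  exact sub_eq_zero.mp (aux_unip p (Nat.card G) hG (φ k) m (φ k • m - m) (by abel)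
    (hk' _ h3) (hM _) (hN _ _))

theorem aux_card {H : Type*} [CommGroup H] [Finite H] (p r : ℕ) (hp : p.Prime)
    (hH : ∀ h : H, h ^ p = 1) (hr : rankLe H r) : Nat.card H ≤ p ^ r := by
  obtain ⟨S, hS, hS'⟩ := hr ⊤
  have h1 := _root_.card_dvd_exponent_pow_rank' H hH
  have h2 : Group.rank H ≤ r := (Group.rank_le hS').trans hS
  exact (Nat.le_of_dvd (pow_pos hp.pos _) h1).trans (Nat.pow_le_pow_right hp.pos h2)

/-- The abelian case of Lemma 2.8: Let `V` be an elementary abelian finite `p`-group, `U` an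
abelian group of coprime automorphisms of `V`, and `r` a positive integer. If the rank of
`[V,u]` is at most `r` for every `u ∈ U`, then the rank of `U` is bounded in terms of `r`. -/
theorem statement_8 :
    ∃ f : ℕ → ℕ,
      ∀ (p : ℕ), p.Prime →
        ∀ (V : Type u) [CommGroup V] [Finite V], (∀ v : V, v ^ p = 1) →
          ∀ (U : Subgroup (MulAut V)), (∀ a ∈ U, ∀ b ∈ U, a * b = b * a) →
            ∀ (r : ℕ), 0 < r →
              (Nat.card U).Coprime p →
              (∀ u ∈ U, rankLe (autCommutator u) r) →
              rankLe U (f r) := by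
  refine ⟨fun r => r, ?_⟩
  intro p hp V _ _ hV U hU r _ hcop hrank K
  letI : CommGroup U := { (inferInstance : Group U) with
    mul_comm := fun a b => Subtype.ext (hU a a.2 b b.2) }
  haveI : Finite (MulAut V) := Finite.of_injective (fun e : MulAut V => (e : V → V))
    DFunLike.coe_injective
  let ψ : U →* AddMonoid.End (Additive V) :=
    { toFun := fun a => MonoidHom.toAdditive (a : MulAut V).toMonoidHom
      map_one' := rfl
      map_mul' := fun _ _ => rfl }
  haveI hcomm : IsMulCommutative (Subring.closure (Set.range ψ)) :=
    Subring.isMulCommutative_closure (by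
      rintro _ ⟨a, rfl⟩ _ ⟨b, rfl⟩
      rw [← map_mul, mul_comm, map_mul])
  letI : CommRing (Subring.closure (Set.range ψ)) :=
    { (inferInstance : Ring (Subring.closure (Set.range ψ))) with
      mul_comm := hcomm.is_comm.comm }
  let φ : U →* Subring.closure (Set.range ψ) :=
    ψ.codRestrict (Subring.closure (Set.range ψ)) fun a => Subring.subset_closure ⟨a, rfl⟩
  have hφ : ∀ (a : U) (v : Additive V), φ a • v = Additive.ofMul ((a : MulAut V) v.toMul) :=
    fun a v => rfl
  refine aux_main φ p hp hcop r (Additive V) (fun v => hV v.toMul) ?_ ?_ K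
  · intro k hk
    ext v
    exact hk (Additive.ofMul v)
  · intro g
    refine le_trans ?_ (aux_card p r hp (H := autCommutator (g : MulAut V))
      (fun h => Subtype.ext (hV h)) (hrank g g.2))
    let F : LinearMap.range (LinearMap.lsmul (Subring.closure (Set.range ψ)) (Additive V)
        (φ g - 1)) → autCommutator (g : MulAut V) := fun w =>
      ⟨w.1.toMul, by
        obtain ⟨w, v, hv⟩ := w
        apply Subgroup.subset_closure
        refine ⟨v.toMul, ?_⟩
        have h1 : (φ g - 1) • v = w := hv
        rw [sub_smul, one_smul, hφ, sub_eq_add_neg, add_comm] at h1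
        change w.toMul = _
        rw [← h1]
        rfl⟩
    exact Nat.card_le_card_of_injective F fun a b h => by
      have h1 : (F a).1 = (F b).1 := congrArg Subtype.val h
      exact Subtype.ext h1
end

section
/- Let V be an elementary abelian finite p-group, U an abelian group of automorphisms of V with gcd(|U|, p) = 1, and let u_1, …, u_k ∈ U be elements such that [V, u_i] ≠ 1 for each i and u_{i+1} centralizes [V, u_1]·[V, u_2]⋯[V, u_i] for each i = 1, …, k−1. Then for w = u_1 u_2 ⋯ u_k one has [V, w] = [V, u_1] × [V, u_2] × ⋯ × [V, u_k] (an internal direct product); in particular the rank of [V, w] is at least k. -/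
universe u


section Helpers

variable {V : Type*} [CommGroup V]

theorem mem_autCommutator_iff (a : MulAut V) (x : V) :
    x ∈ autCommutator a ↔ ∃ v : V, x = v⁻¹ * a v := by
  constructor
  · intro hx
    induction hx using Subgroup.closure_induction with
    | mem x hx => exact hx
    | one => exact ⟨1, by simp⟩
    | mul x y _ _ hx hy =>
      obtain ⟨v, rfl⟩ := hx
      obtain ⟨w, rfl⟩ := hy
      refine ⟨v * w, ?_⟩
      rw [map_mul, mul_inv]
      exact mul_mul_mul_comm _ _ _ _
    | inv x _ hx =>
      obtain ⟨v, rfl⟩ := hx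
      refine ⟨v⁻¹, ?_⟩
      rw [map_inv, mul_inv]
  · intro h
    exact Subgroup.subset_closure h

theorem fixed_autCommutator_eq_one {p : ℕ} (hV : ∀ v : V, v ^ p = 1) (a : MulAut V)
    (ha : (orderOf a).Coprime p) (x : V) (hx : x ∈ autCommutator a) (hf : a x = x) : x = 1 := by
  obtain ⟨v, hv⟩ := (mem_autCommutator_iff a x).1 hx
  have hav : a v = v * x := by rw [hv]; simp
  have hpow : ∀ n : ℕ, (a ^ n) v = v * x ^ n := by
    intro n
    induction n with
    | zero => simp
    | succ n ih =>
      rw [pow_succ', MulAut.mul_apply, ih, map_mul, map_pow, hav, hf, pow_succ', mul_assoc]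
  have h1 : x ^ orderOf a = 1 := by
    have := hpow (orderOf a)
    rw [pow_orderOf_eq_one, MulAut.one_apply] at this
    exact (left_eq_mul.1 this)
  have h2 := pow_gcd_eq_one.2 ⟨h1, hV x⟩
  rw [Nat.Coprime.gcd_eq_one ha, pow_one] at h2
  exact h2

theorem map_mem_autCommutator (a : MulAut V) (x : V) (hx : x ∈ autCommutator a) :
    a x ∈ autCommutator a := by
  obtain ⟨v, rfl⟩ := (mem_autCommutator_iff a x).1 hx
  exact (mem_autCommutator_iff a _).2 ⟨a v, by simp⟩

/-- `[[V, a], a] = [V, a]` in the coprime case. -/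
theorem exists_mem_autCommutator [Finite V] {p : ℕ} (hV : ∀ v : V, v ^ p = 1) (a : MulAut V)
    (ha : (orderOf a).Coprime p) (x : V) (hx : x ∈ autCommutator a) :
    ∃ y ∈ autCommutator a, x = y⁻¹ * a y := by
  let f : autCommutator a → autCommutator a := fun y =>
    ⟨(y : V)⁻¹ * a y, mul_mem (inv_mem y.2) (map_mem_autCommutator a y y.2)⟩
  have hf : Function.Injective f := by
    intro y z hyz
    have h : (y : V)⁻¹ * a y = (z : V)⁻¹ * a z := congrArg Subtype.val hyz
    have h2 : a ((y : V) * (z : V)⁻¹) = (y : V) * (z : V)⁻¹ := by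
      rw [inv_mul_eq_iff_eq_mul] at h
      rw [map_mul, map_inv, h]
      group
    have h3 := fixed_autCommutator_eq_one hV a ha _ (mul_mem y.2 (inv_mem z.2)) h2
    exact Subtype.ext (mul_inv_eq_one.1 h3)
  obtain ⟨y, hy⟩ := (Finite.surjective_of_injective hf) ⟨x, hx⟩
  exact ⟨y, y.2, (congrArg Subtype.val hy).symm⟩

theorem list_prod_fix (l : List (MulAut V)) (x : V) (h : ∀ a ∈ l, a x = x) : l.prod x = x := by
  induction l with
  | nil => simp
  | cons b l ih =>
    rw [List.prod_cons, MulAut.mul_apply, ih fun a ha => h a (by simp [ha]), h b (by simp)]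

theorem list_prod_apply (l : List (MulAut V))
    (hl : l.Pairwise fun a b => (∀ x ∈ autCommutator a, b x = x) ∧
      (∀ x ∈ autCommutator b, a x = x)) :
    ∀ a ∈ l, ∀ x ∈ autCommutator a, l.prod x = a x := by
  induction l with
  | nil => simp
  | cons b l ih =>
    rw [List.pairwise_cons] at hl
    intro a ha x hx
    rw [List.prod_cons, MulAut.mul_apply]
    rcases List.mem_cons.1 ha with rfl | ha
    · rw [list_prod_fix l x fun c hc => (hl.1 c hc).1 x hx]
    · rw [ih hl.2 a ha x hx]
      exact (hl.1 a ha).2 _ (map_mem_autCommutator a x hx)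

theorem autCommutator_list_prod_le (l : List (MulAut V)) (H : Subgroup V)
    (h : ∀ a ∈ l, autCommutator a ≤ H) : autCommutator l.prod ≤ H := by
  induction l with
  | nil =>
    intro x hx
    obtain ⟨v, rfl⟩ := (mem_autCommutator_iff _ x).1 hx
    simp
  | cons b l ih =>
    intro x hx
    obtain ⟨v, rfl⟩ := (mem_autCommutator_iff _ x).1 hx
    have h1 : v⁻¹ * l.prod v ∈ H :=
      ih (fun a ha => h a (by simp [ha])) ((mem_autCommutator_iff _ _).2 ⟨v, rfl⟩)
    have h2 : (l.prod v)⁻¹ * b (l.prod v) ∈ H :=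
      h b (by simp) ((mem_autCommutator_iff _ _).2 ⟨_, rfl⟩)
    have := mul_mem h1 h2
    rw [List.prod_cons, MulAut.mul_apply]
    simpa [mul_assoc] using this

theorem card_le_of_indep {p : ℕ} (hp : p.Prime) (hV : ∀ v : V, v ^ p = 1) {k : ℕ}
    (A : Fin k → Subgroup V) (hA : ∀ i, A i ≠ ⊥) (hind : iSupIndep A) (W : Subgroup V)
    (hW : ∀ i, A i ≤ W) (m : ℕ) (hm : rankLe W m) : k ≤ m := by
  haveI : Fact p.Prime := ⟨hp⟩
  letI : Module (ZMod p) (Additive V) := AddCommGroup.zmodModule (n := p) fun x => hV x.toMul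
  obtain ⟨S, hS, hcl⟩ := hm ⊤
  have hclV : Subgroup.closure ((fun x : W => (x : V)) '' (S : Set W)) = W := by
    have := MonoidHom.map_closure W.subtype (S : Set W)
    rw [hcl, ← MonoidHom.range_eq_map, Subgroup.range_subtype] at this
    exact this.symm
  let T : Set (Additive V) := (fun x : W => Additive.ofMul (x : V)) '' (S : Set W)
  let e : Subgroup V ≃o Submodule (ZMod p) (Additive V) :=
    Subgroup.toAddSubgroup.trans (AddSubgroup.toZModSubmodule p)
  have hex : ∀ i, ∃ x ∈ A i, x ≠ 1 := fun i => (Subgroup.ne_bot_iff_exists_ne_one).1 (hA i) |>.elim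
    fun x hx => ⟨x, x.2, fun h => hx (Subtype.ext h)⟩
  choose x hx hx1 using hex
  have hind' : iSupIndep (e ∘ A) := hind.map_orderIso e
  have hlin : LinearIndependent (ZMod p) (fun i => Additive.ofMul (x i)) :=
    hind'.linearIndependent _ (fun i => hx i) (fun i => hx1 i)
  have hle : W ≤ e.symm (Submodule.span (ZMod p) T) := by
    rw [← hclV, Subgroup.closure_le]
    rintro _ ⟨s, hs, rfl⟩
    exact Submodule.subset_span (s := T) ⟨s, hs, rfl⟩
  classical
  have hT : T = ((S.image fun x : W => Additive.ofMul (x : V) : Finset (Additive V)) :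
      Set (Additive V)) := by simp [T]
  have h1 : (Submodule.span (ZMod p) (Set.range fun i => Additive.ofMul (x i))) ≤
      Submodule.span (ZMod p) T := by
    rw [Submodule.span_le]
    rintro _ ⟨i, rfl⟩
    exact hle (hW i (hx i))
  rw [hT] at h1
  haveI : Module.Finite (ZMod p) (Submodule.span (ZMod p)
    ((S.image fun x : W => Additive.ofMul (x : V) : Finset (Additive V)) :
      Set (Additive V))) := FiniteDimensional.span_finset _ _
  have h2 := Submodule.finrank_mono h1
  rw [finrank_span_eq_card hlin, Fintype.card_fin] at h2
  exact h2.trans ((finrank_span_finset_le_card _).trans (Finset.card_image_le.trans hS))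

end Helpers

/-- A step in the proof of Lemma 2.8: if `V` is an elementary abelian finite `p`-group, `U` an
abelian group of coprime automorphisms of `V`, and `u₁, …, u_k ∈ U` are such that `[V,uᵢ] ≠ 1`
and `u_{i+1}` centralizes `[V,u₁]⋯[V,uᵢ]`, then for `w = u₁u₂⋯u_k` the subgroup `[V,w]` is the
internal direct product `[V,u₁] × ⋯ × [V,u_k]`; in particular `[V,w]` has rank at least `k`. -/
theorem statement_9 (p : ℕ) (hp : p.Prime) (V : Type u) [CommGroup V] [Finite V]
    (hV : ∀ v : V, v ^ p = 1) (U : Subgroup (MulAut V))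
    (hcop : (Nat.card U).Coprime p)
    (hab : ∀ a ∈ U, ∀ b ∈ U, a * b = b * a)
    (k : ℕ) (u : Fin k → MulAut V) (hu : ∀ i, u i ∈ U)
    (hne : ∀ i, autCommutator (u i) ≠ ⊥)
    (hcent : ∀ i j : Fin k, j < i → ∀ x ∈ autCommutator (u j), (u i) x = x) :
    (autCommutator (List.ofFn u).prod = ⨆ i, autCommutator (u i)) ∧
    iSupIndep (fun i => autCommutator (u i)) ∧
    (∀ m : ℕ, rankLe (autCommutator (List.ofFn u).prod) m → k ≤ m) := by
  have hord : ∀ i, (orderOf (u i)).Coprime p := by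
    intro i
    refine Nat.Coprime.coprime_dvd_left ?_ hcop
    have := orderOf_dvd_natCard (⟨u i, hu i⟩ : U)
    rwa [← Subgroup.orderOf_coe] at this
  have hcent' : ∀ i j : Fin k, j ≠ i → ∀ x ∈ autCommutator (u j), (u i) x = x := by
    intro i j hij x hx
    rcases lt_or_gt_of_ne hij with h | h
    · exact hcent i j h x hx
    · obtain ⟨v, rfl⟩ := (mem_autCommutator_iff _ x).1 hx
      have hc : (u j) (v⁻¹ * u i v) = v⁻¹ * u i v :=
        hcent j i h _ ((mem_autCommutator_iff _ _).2 ⟨v, rfl⟩)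
      have hcomm : u i (u j v) = u j (u i v) :=
        DFunLike.congr_fun (hab (u i) (hu i) (u j) (hu j)) v
      rw [map_mul, map_inv] at hc ⊢
      rw [inv_mul_eq_iff_eq_mul] at hc ⊢
      rw [hcomm, hc]
      simp [mul_left_comm, mul_comm]
  have hpair : (List.ofFn u).Pairwise fun a b => (∀ x ∈ autCommutator a, b x = x) ∧
      (∀ x ∈ autCommutator b, a x = x) := by
    rw [List.pairwise_ofFn]
    intro i j hij
    exact ⟨hcent' j i hij.ne, hcent' i j hij.ne'⟩
  have hle : ∀ i, autCommutator (u i) ≤ autCommutator (List.ofFn u).prod := by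
    intro i x hx
    obtain ⟨y, hy, rfl⟩ := exists_mem_autCommutator hV (u i) (hord i) x hx
    refine (mem_autCommutator_iff _ _).2 ⟨y, ?_⟩
    rw [list_prod_apply _ hpair (u i) (by simp [List.mem_ofFn]) y hy]
  have hind : iSupIndep (fun i => autCommutator (u i)) := by
    intro i
    rw [Subgroup.disjoint_def]
    intro x hx hx'
    refine fixed_autCommutator_eq_one hV (u i) (hord i) x hx ?_
    have hsup : (⨆ j, ⨆ (_ : j ≠ i), autCommutator (u j)) ≤
        MonoidHom.eqLocus (u i).toMonoidHom (MonoidHom.id V) :=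
      iSup_le fun j => iSup_le fun hj y hy => hcent' i j hj y hy
    exact hsup hx'
  refine ⟨le_antisymm ?_ (iSup_le hle), hind, ?_⟩
  · refine autCommutator_list_prod_le _ _ fun a ha => ?_
    obtain ⟨i, rfl⟩ := (List.mem_ofFn' u a).1 ha
    exact le_iSup (fun i => autCommutator (u i)) i
  · intro m hm
    exact card_le_of_indep hp hV _ hne hind _ hle m hm
end

section
/- Let G be a finite group and τ ∈ G an involution, and set J(τ) = {g ∈ G : g has odd order and g^τ = g^{-1}}. Then for every g ∈ J(τ) the cyclic subgroup ⟨g⟩ is contained both in the smallest left Engel sink 𝓔_G(τ) and in the smallest right Engel sink 𝓡_G(τ) of τ; in particular J(τ) ⊆ ⟨𝓔_G(τ)⟩ and J(τ) ⊆ ⟨𝓡_G(τ)⟩. -/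
universe u

theorem engel_of_inverted {G : Type*} [Group G] (y t : G) (h : t⁻¹ * y * t = y⁻¹) (n : ℕ) :
    engel y t n = y ^ ((-2 : ℤ) ^ n) := by
  induction n with
  | zero => simp [engel]
  | succ n ih =>
    have key : ∀ k : ℤ, t⁻¹ * y ^ k * t = y ^ (-k) := by
      intro k
      have h1 := conj_zpow (i := k) (a := t⁻¹) (b := y)
      rw [inv_inv, h] at h1
      rw [← h1, inv_zpow, zpow_neg]
    have e : engel y t (n + 1) = (engel y t n)⁻¹ * (t⁻¹ * engel y t n * t) := by
      simp [engel, gComm, mul_assoc]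
    rw [e, ih, key, ← zpow_neg, ← zpow_add]
    congr 1
    ring

theorem zpow_neg_two_period {G : Type*} [Group G] (y : G) (h : Odd (orderOf y)) (N : ℕ) :
    y ^ ((-2 : ℤ) ^ ((orderOf y).totient * 2 * N)) = y := by
  have hc : Nat.Coprime 2 (orderOf y) := (Nat.coprime_two_left).2 h
  have h1 := ((Nat.ModEq.pow_totient hc).pow 2).pow N
  have h2 : (-2 : ℤ) ^ ((orderOf y).totient * 2 * N)
      = ((((2 ^ (orderOf y).totient) ^ 2) ^ N : ℕ) : ℤ) := by
    push_cast
    rw [← pow_mul, ← pow_mul, ← mul_assoc]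
    apply Even.neg_pow
    exact (even_two.mul_left _).mul_right _
  rw [h2, zpow_natCast]
  rw [one_pow, one_pow] at h1
  conv_rhs => rw [← pow_one y]
  exact pow_eq_pow_iff_modEq.2 h1

theorem engel_shift {G : Type*} [Group G] (a x : G) (n : ℕ) :
    engel a x (n + 1) = engel (gComm a x) x n := by
  induction n with
  | zero => rfl
  | succ n ih => rw [engel, ih, engel]

theorem mem_sinks {G : Type*} [Group G] [Finite G] (τ : G) (hτ : orderOf τ = 2) (h : G)
    (ho : Odd (orderOf h)) (hi : τ⁻¹ * h * τ = h⁻¹) :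
    h ∈ leftEngelSink τ ∧ h ∈ rightEngelSink τ := by
  have hpos : 0 < (orderOf h).totient := Nat.totient_pos.2 (orderOf_pos h)
  have hN : ∀ N : ℕ, N ≤ (orderOf h).totient * 2 * N := fun N =>
    Nat.le_mul_of_pos_left N (by positivity)
  have hττ : τ * τ = 1 := by rw [← pow_two, ← hτ, pow_orderOf_eq_one]
  have hτi : τ⁻¹ = τ := inv_eq_of_mul_eq_one_left hττ
  constructor
  · intro E hE
    obtain ⟨N, -, hl⟩ := hE h
    have := hl _ (hN N)
    rwa [engel_of_inverted _ _ hi, zpow_neg_two_period _ ho] at this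
  · intro R hR
    obtain ⟨k, hk⟩ := ho
    have hy2 : h ^ (k + 1) * h ^ (k + 1) = h := by
      rw [← pow_add, show k + 1 + (k + 1) = orderOf h + 1 by omega, pow_succ,
        pow_orderOf_eq_one, one_mul]
    have hyi : τ⁻¹ * h ^ (k + 1) * τ = (h ^ (k + 1))⁻¹ := by
      have h1 := conj_pow (i := k + 1) (a := τ⁻¹) (b := h)
      rw [inv_inv, hi] at h1
      rw [← h1, inv_pow]
    have hcomm : Commute h (h ^ (k + 1)) := (Commute.refl h).pow_right _
    generalize h ^ (k + 1) = y at *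
    have hx : (τ * y)⁻¹ * h * (τ * y) = h⁻¹ := by
      have : (τ * y)⁻¹ * h * (τ * y) = y⁻¹ * (τ⁻¹ * h * τ) * y := by group
      rw [this, hi, mul_assoc, (hcomm.inv_left).eq, inv_mul_cancel_left]
    have hg : gComm τ (τ * y) = h := by
      have h3 : gComm τ (τ * y) = (τ⁻¹ * y * τ)⁻¹ * y := by
        simp [gComm, mul_assoc, hτi]
        rw [← mul_assoc τ τ y, hττ, one_mul]
      rw [h3, hyi, inv_inv, hy2]
    obtain ⟨N, -, hl⟩ := hR (τ * y)
    have := hl _ ((hN N).trans (Nat.le_succ _))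
    rwa [Nat.succ_eq_add_one, engel_shift, hg, engel_of_inverted _ _ hx,
      zpow_neg_two_period _ ⟨k, hk⟩] at this

/-- A step in the proof of Proposition 4.2: let `G` be a finite group, `τ ∈ G` an involution,
and `J(τ) = {g ∈ G : g` has odd order and `g^τ = g⁻¹}`. Then for every `g ∈ J(τ)` the cyclic
subgroup `⟨g⟩` is contained in both the smallest left Engel sink `𝓔_G(τ)` and the smallest
right Engel sink `𝓡_G(τ)`; in particular `J(τ) ⊆ ⟨𝓔_G(τ)⟩` and `J(τ) ⊆ ⟨𝓡_G(τ)⟩`. -/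
theorem statement_11 (G : Type u) [Group G] [Finite G] (τ : G) (hτ : orderOf τ = 2) :
    (∀ g : G, Odd (orderOf g) → τ⁻¹ * g * τ = g⁻¹ →
      ∀ x ∈ Subgroup.zpowers g, x ∈ leftEngelSink τ ∧ x ∈ rightEngelSink τ) ∧
    {g : G | Odd (orderOf g) ∧ τ⁻¹ * g * τ = g⁻¹} ⊆
      (Subgroup.closure (leftEngelSink τ) : Set G) ∧
    {g : G | Odd (orderOf g) ∧ τ⁻¹ * g * τ = g⁻¹} ⊆
      (Subgroup.closure (rightEngelSink τ) : Set G) := by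
  have main : ∀ g : G, Odd (orderOf g) → τ⁻¹ * g * τ = g⁻¹ →
      ∀ x ∈ Subgroup.zpowers g, x ∈ leftEngelSink τ ∧ x ∈ rightEngelSink τ := by
    rintro g ho hi x ⟨k, rfl⟩
    refine mem_sinks τ hτ _ (ho.of_dvd_nat (orderOf_dvd_of_mem_zpowers ⟨k, rfl⟩)) ?_
    have h1 := conj_zpow (i := k) (a := τ⁻¹) (b := g)
    rw [inv_inv, hi] at h1
    change τ⁻¹ * g ^ k * τ = (g ^ k)⁻¹
    rw [← h1, inv_zpow]
  refine ⟨main, ?_, ?_⟩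
  · rintro g ⟨ho, hi⟩
    exact Subgroup.subset_closure (main g ho hi g (Subgroup.mem_zpowers g)).1
  · rintro g ⟨ho, hi⟩
    exact Subgroup.subset_closure (main g ho hi g (Subgroup.mem_zpowers g)).2
end
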